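/- arXiv:2310.11704 — 3 statements merged into one kernel-verified Lean document; each statement's English description precedes it below -/
import Mathlib

section
/- Let m ≥ 2 be an integer, let P_m denote the path on m vertices, and let H be a connected simple graph of order n. Then p(P_m □ H) ≤ mn/2, i.e., the edges of the cartesian product of P_m and H can be decomposed into at most mn/2 edge-disjoint paths. -/
open SimpleGraph

/-- `P` is a path decomposition of `G`: a list of edge-disjoint paths of `G`
covering all the edges of `G`. -/
def SimpleGraph.IsPathDecomp {V : Type*} (G : SimpleGraph V)
    (P : List (Σ u v : V, G.Walk u v)) : Prop :=
  (∀ p ∈ P, p.2.2.IsPath) ∧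
  P.Pairwise (fun p q => ∀ e ∈ p.2.2.edges, e ∉ q.2.2.edges) ∧
  ∀ e ∈ G.edgeSet, ∃ p ∈ P, e ∈ p.2.2.edges

/-- `p(G)`: the minimum number of paths in a path decomposition of `G`. -/
noncomputable def SimpleGraph.pathNumber {V : Type*} (G : SimpleGraph V) : ℕ :=
  sInf {k | ∃ P, G.IsPathDecomp P ∧ P.length = k}

namespace PathDecomp

variable {V : Type*}

/-- The multiset of edges joining consecutive entries of a list. -/
def edg : List V → Multiset (Sym2 V)
  | [] => 0
  | [_] => 0
  | a :: b :: l => s(a, b) ::ₘ edg (b :: l)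

/-- The two ends of a list. -/
def ends (l : List V) : Multiset (Option V) := {l.head?, l.getLast?}

/-- A collection of nonempty lists without repetitions. -/
def Good (D : Multiset (List V)) : Prop := ∀ l ∈ D, l.Nodup ∧ l ≠ []

lemma edg_append_cons (l : List V) (a : V) (r : List V) :
    edg (l ++ a :: r) = edg (l ++ [a]) + edg (a :: r) := by
  induction l with
  | nil => simp [edg]
  | cons b l ih => cases l with
    | nil => simp [edg]
    | cons d l => simpa [edg] using ih

lemma edg_append_pair (l : List V) (a b : V) :
    edg (l ++ [a, b]) = edg (l ++ [a]) + {s(a, b)} := by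
  rw [edg_append_cons]; simp [edg]

lemma edg_reverse (l : List V) : edg l.reverse = edg l := by
  induction l with
  | nil => simp
  | cons a l ih => cases l with
    | nil => simp
    | cons b l =>
      have : (a :: b :: l).reverse = l.reverse ++ [b, a] := by simp
      rw [this, edg_append_pair]
      simp only [List.reverse_cons] at ih
      rw [ih, edg, Sym2.eq_swap, add_comm, Multiset.singleton_add]

lemma edg_map {X : Type*} (f : V → X) (l : List V) :
    edg (l.map f) = (edg l).map (Sym2.map f) := by
  induction l with
  | nil => simp [edg]
  | cons a l ih => cases l with
    | nil => simp [edg]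
    | cons b l => simpa [edg] using ih

lemma ends_reverse (l : List V) : ends l.reverse = ends l := by
  simp only [ends, List.head?_reverse, List.getLast?_reverse]
  exact Multiset.pair_comm _ _

lemma good_cons {l : List V} {D : Multiset (List V)} (h : l.Nodup) (h' : l ≠ []) (hD : Good D) :
    Good (l ::ₘ D) := by
  intro k hk
  rcases Multiset.mem_cons.1 hk with rfl | hk
  · exact ⟨h, h'⟩
  · exact hD k hk

section Flags

variable [DecidableEq V]

/-- The first entry of a list together with the entry preceding `c`, if any. -/
def flag (c : V) (l : List V) : Option V × Option V :=
  (l.head?, if c ∈ l then (l.takeWhile (· ≠ c)).getLast? else none)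

/-- The flags at both ends of a list. -/
def flags (c : V) (l : List V) : Multiset (Option V × Option V) := {flag c l, flag c l.reverse}

lemma flags_reverse (c : V) (l : List V) : flags c l.reverse = flags c l := by
  simp only [flags, List.reverse_reverse]
  exact Multiset.pair_comm _ _

lemma flag_append {c : V} {a : List V} (h : c ∉ a) (r : List V) :
    flag c (a ++ c :: r) = ((a ++ [c]).head?, a.getLast?) := by
  have : (a ++ c :: r).takeWhile (· ≠ c) = a := by
    rw [List.takeWhile_append_of_pos]
    · simp
    · intro x hx; simpa using ne_of_mem_of_not_mem hx h
  rw [flag, this]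
  cases a <;> simp

lemma bind_flags_fst (c : V) (D : Multiset (List V)) :
    (D.bind (flags c)).map Prod.fst = D.bind ends := by
  rw [Multiset.map_bind]
  congr 1; ext1 l
  simp [flags, ends, flag]

lemma exists_of_mem_flags {c : V} {D : Multiset (List V)} (hD : Good D) {x}
    (hx : x ∈ D.bind (flags c)) :
    ∃ l D₀, flag c l = x ∧ l.Nodup ∧ l ≠ [] ∧ Good D₀ ∧ D.card = D₀.card + 1 ∧
      D.bind edg = edg l + D₀.bind edg ∧
      D.bind ends = ends l + D₀.bind ends ∧
      D.bind (flags c) = flags c l + D₀.bind (flags c) := by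
  obtain ⟨l, hl, hxl⟩ := Multiset.mem_bind.1 hx
  obtain ⟨D₀, rfl⟩ := Multiset.exists_cons_of_mem hl
  have h₀ : Good D₀ := fun k hk => hD k (Multiset.mem_cons_of_mem hk)
  have hl' := hD l hl
  rw [flags, Multiset.insert_eq_cons, Multiset.mem_cons, Multiset.mem_singleton] at hxl
  rcases hxl with hx | hx
  · exact ⟨l, D₀, hx.symm, hl'.1, hl'.2, h₀, by simp, by simp, by simp, by simp⟩
  · exact ⟨l.reverse, D₀, hx.symm, List.nodup_reverse.2 hl'.1, by simpa using hl'.2, h₀,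
      by simp, by simp [edg_reverse], by simp [ends_reverse], by simp [flags_reverse]⟩

/-- Reversing the part of a path that precedes `c`. -/
lemma exists_swap {c y w : V} {D : Multiset (List V)} (hD : Good D)
    {Ψ : Multiset (Option V × Option V)} (h : D.bind (flags c) = (some y, some w) ::ₘ Ψ) :
    ∃ D', Good D' ∧ D'.bind edg + {s(c, w)} = D.bind edg + {s(c, y)} ∧
      D'.bind (flags c) = (some w, some y) ::ₘ Ψ := by
  obtain ⟨l, D₀, hf, hn, -, hD₀, -, hE, -, hΦ⟩ := exists_of_mem_flags hD
    (show (some y, some w) ∈ D.bind (flags c) by simp [h])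
  have hc : c ∈ l := by
    by_contra hc
    simp [flag, hc] at hf
  obtain ⟨a, r, rfl, hca⟩ := List.eq_append_cons_of_mem hc
  have hf' := hf
  rw [flag_append hca, Prod.mk.injEq] at hf
  obtain ⟨hy, hw⟩ := hf
  have hcr : c ∉ r := by
    have := hn
    rw [List.nodup_append, List.nodup_cons] at this
    exact this.2.1.1
  obtain ⟨a', rfl⟩ := List.getLast?_eq_some_iff.1 hw
  obtain ⟨a'', ha''⟩ : ∃ b, a' ++ [w] = y :: b := by
    apply List.head?_eq_some_iff.1
    cases a' <;> simpa using hy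
  refine ⟨((a' ++ [w]).reverse ++ c :: r) ::ₘ D₀, good_cons ?_ (by simp) hD₀, ?_, ?_⟩
  · refine (List.Perm.nodup_iff ?_).1 hn
    exact (List.reverse_perm _).symm.append_right _
  · have h1 : edg ((a' ++ [w]).reverse ++ c :: r) =
        edg (a' ++ [w]) + {s(c, y)} + edg (c :: r) := by
      rw [edg_append_cons]
      congr 1
      rw [← edg_reverse (a' ++ [w]), ha'', List.reverse_cons, List.append_assoc]
      rw [Sym2.eq_swap]
      exact edg_append_pair _ _ _
    have h2 : edg (a' ++ [w] ++ c :: r) =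
        edg (a' ++ [w]) + {s(c, w)} + edg (c :: r) := by
      rw [edg_append_cons, List.append_assoc, Sym2.eq_swap]
      congr 1
      exact edg_append_pair _ _ _
    rw [Multiset.cons_bind, hE, h1, h2]
    abel
  · have h1 : flags c (a' ++ [w] ++ c :: r) = (some y, some w) ::ₘ {flag c (r.reverse ++ [c])} := by
      rw [flags, hf']
      have : (a' ++ [w] ++ c :: r).reverse = r.reverse ++ c :: (a' ++ [w]).reverse := by simp
      rw [this, flag_append (by simpa using hcr), flag_append (by simpa using hcr)]
      rfl
    have h2 : flags c ((a' ++ [w]).reverse ++ c :: r) =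
        (some w, some y) ::ₘ {flag c (r.reverse ++ [c])} := by
      have : ((a' ++ [w]).reverse ++ c :: r).reverse = r.reverse ++ c :: (a' ++ [w]) := by simp
      have hca' : c ∉ (a' ++ [w]).reverse := by rwa [List.mem_reverse]
      have hcr' : c ∉ r.reverse := by simpa using hcr
      rw [flags, this, flag_append hca', flag_append hcr', flag_append hcr', List.getLast?_reverse,
        ha'']
      rw [List.head?_cons, ← ha'', List.reverse_append]
      rfl
    rw [Multiset.cons_bind, h2]
    rw [hΦ, h1] at h
    simpa using h

/-- Extending a path that avoids `c` by an edge to `c`. -/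
lemma exists_attach {c y : V} (hyc : y ≠ c) {D : Multiset (List V)} (hD : Good D)
    (h : (some y, none) ∈ D.bind (flags c)) :
    ∃ D', Good D' ∧ D'.bind edg = D.bind edg + {s(c, y)} ∧
      D'.bind ends + {some y} = D.bind ends + {some c} := by
  obtain ⟨l, D₀, hf, hn, -, hD₀, -, hE, hN, -⟩ := exists_of_mem_flags hD h
  obtain ⟨b, rfl⟩ : ∃ b, l = y :: b := by
    apply List.head?_eq_some_iff.1
    simpa [flag] using (Prod.mk.inj hf).1
  have hc : c ∉ y :: b := by
    intro hc
    have := (Prod.mk.inj hf).2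
    rw [if_pos hc] at this
    simp [hyc] at this
  refine ⟨(c :: y :: b) ::ₘ D₀, good_cons (List.nodup_cons.2 ⟨hc, hn⟩) (by simp) hD₀, ?_, ?_⟩
  · rw [Multiset.cons_bind, hE, edg, ← Multiset.singleton_add]
    abel
  · rw [Multiset.cons_bind, hN]
    simp only [ends, List.head?_cons, List.getLast?_cons_cons, Multiset.insert_eq_cons,
      ← Multiset.singleton_add]
    abel

lemma exists_add_edge_aux {c : V} (n : ℕ) : ∀ (Ψ Φ : Multiset (Option V × Option V))
    (D : Multiset (List V)) (y : V), Ψ.card = n → Good D → D.bind (flags c) = Ψ + Φ →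
    (∀ w : V, (some y ::ₘ Ψ.map Prod.snd).count (some w) ≤ 1) →
    (∀ w : V, some w ∈ some y ::ₘ Ψ.map Prod.snd → w ≠ c ∧ some w ∈ Ψ.map Prod.fst) →
    ∃ D', Good D' ∧ D'.bind edg = D.bind edg + {s(c, y)} ∧
      D'.bind ends + {some y} = D.bind ends + {some c} := by
  induction n with
  | zero =>
    intro Ψ Φ D y hn hD hΦ hI hO
    have := (hO y (by simp)).2
    simp [Multiset.card_eq_zero.1 hn] at this
  | succ n ih =>
    intro Ψ Φ D y hn hD hΦ hI hO
    obtain ⟨hyc, hy⟩ := hO y (by simp)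
    obtain ⟨⟨y', o⟩, hmem, rfl⟩ := Multiset.mem_map.1 hy
    cases o with
    | none => exact exists_attach hyc hD (by simp [hΦ, hmem])
    | some w =>
      obtain ⟨Ψ, rfl⟩ := Multiset.exists_cons_of_mem hmem
      obtain ⟨D₁, hD₁, hE, hF⟩ := exists_swap (Ψ := Ψ + Φ) hD (by simpa using hΦ)
      obtain ⟨D', hD', hE', hN'⟩ := ih Ψ ((some w, some y) ::ₘ Φ) D₁ w (by simpa using hn) hD₁
        (by simpa using hF)
        (fun v => le_trans (Multiset.count_le_of_le _ (by simpa using Multiset.le_cons_self _ _))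
          (hI v))
        (by
          intro v hv
          have h1 := hO v (by simp at hv ⊢; tauto)
          refine ⟨h1.1, ?_⟩
          have h2 := h1.2
          simp only [Multiset.map_cons, Multiset.mem_cons] at h2
          refine h2.resolve_left fun e => ?_
          have h3 := hI v
          have h4 := Multiset.one_le_count_iff_mem.2 hv
          rw [e] at h3 h4
          simp only [Multiset.map_cons] at h3
          rw [Multiset.count_cons_self] at h3
          omega)
      refine ⟨D', hD', by rw [hE', hE], ?_⟩
      have h5 : D₁.bind ends + {some y} = D.bind ends + {some w} := by
        rw [← bind_flags_fst c, ← bind_flags_fst c, hF, hΦ]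
        simp only [Multiset.map_cons, Multiset.map_add]
        simp only [← Multiset.singleton_add]
        abel
      have h6 : D'.bind ends + {some y} + {some w} = D.bind ends + {some c} + {some w} := by
        rw [add_right_comm, hN', add_right_comm, h5]
        abel
      exact add_right_cancel h6

lemma count_flags_snd_le (c w : V) {l : List V} (hd : l.Nodup) :
    ((flags c l).map Prod.snd).count (some w) ≤ (edg l).count s(c, w) := by
  by_cases hc : c ∈ l
  · obtain ⟨a, r, rfl, hca⟩ := List.eq_append_cons_of_mem hc
    have hcr : c ∉ r := by
      rw [List.nodup_append, List.nodup_cons] at hd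
      exact hd.2.1.1
    have : (a ++ c :: r).reverse = r.reverse ++ c :: a.reverse := by simp
    rw [flags, this, flag_append hca, flag_append (by simpa using hcr), edg_append_cons]
    rw [Multiset.insert_eq_cons, Multiset.map_cons, Multiset.map_singleton,
      List.getLast?_reverse, ← Multiset.singleton_add, Multiset.count_add, Multiset.count_add]
    refine Nat.add_le_add ?_ ?_
    · rcases List.eq_nil_or_concat a with rfl | ⟨a, v, rfl⟩
      · simp
      · simp only [List.concat_eq_append, List.append_assoc, List.getLast?_append,
          List.cons_append, List.nil_append, edg_append_pair]
        by_cases h : v = w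
        · subst h; simp [Sym2.eq_swap]
        · simp [Ne.symm h]
    · cases r with
      | nil => simp
      | cons v r =>
        by_cases h : v = w
        · subst h; simp [edg]
        · simp [Ne.symm h]
  · simp [flags, flag, hc]

/-- Lovász's exchange argument: if every neighbour of `c` is an end of a path, then
an edge `cy` may be added at the cost of moving an end from `y` to `c`. -/
lemma exists_add_edge {c y : V} {D : Multiset (List V)} (hD : Good D)
    (hn : (s(c, y) ::ₘ D.bind edg).Nodup) (hl : ∀ e ∈ s(c, y) ::ₘ D.bind edg, ¬ e.IsDiag)
    (hN : ∀ w, s(c, w) ∈ s(c, y) ::ₘ D.bind edg → some w ∈ D.bind ends) :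
    ∃ D', Good D' ∧ D'.bind edg = D.bind edg + {s(c, y)} ∧
      D'.bind ends + {some y} = D.bind ends + {some c} := by
  have key : ∀ w : V, (some y ::ₘ (D.bind (flags c)).map Prod.snd).count (some w) ≤
      (s(c, y) ::ₘ D.bind edg).count s(c, w) := by
    intro w
    have h2 : ((D.bind (flags c)).map Prod.snd).count (some w) ≤ (D.bind edg).count s(c, w) := by
      rw [Multiset.map_bind, Multiset.count_bind, Multiset.count_bind]
      exact Multiset.sum_map_le_sum_map _ _ fun l hl => count_flags_snd_le c w (hD l hl).1
    by_cases h : w = y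
    · subst h; simpa using h2
    · rw [Multiset.count_cons_of_ne (by simpa using h)]
      exact h2.trans (Multiset.count_le_of_le _ (Multiset.le_cons_self _ _))
  refine exists_add_edge_aux _ (D.bind (flags c)) 0 D y rfl hD (by simp)
    (fun w => (key w).trans (Multiset.nodup_iff_count_le_one.1 hn _)) fun w hw => ?_
  have hm : s(c, w) ∈ s(c, y) ::ₘ D.bind edg :=
    Multiset.one_le_count_iff_mem.1 ((Multiset.one_le_count_iff_mem.2 hw).trans (key w))
  refine ⟨fun e => hl _ hm (by simp [e]), ?_⟩
  rw [bind_flags_fst]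
  exact hN w hm

/-- A loopless edge set on `U` decomposes into paths so that each vertex of `U` is the end of
one or two paths, except for a prescribed one, which is the end of at most one path. -/
lemma exists_decomp_aux (n : ℕ) : ∀ (U : Finset V) (M : Multiset (Sym2 V)) (x : V),
    M.card + U.card = n → x ∈ U → M.Nodup → (∀ e ∈ M, ¬ e.IsDiag) →
    (∀ e ∈ M, ∀ v ∈ e, v ∈ U) →
    ∃ D, Good D ∧ D.bind edg = M ∧ (∀ v ∉ U, (D.bind ends).count (some v) = 0) ∧
      (D.bind ends).count (some x) ≤ 1 ∧
      ∀ v ∈ U, v ≠ x → 1 ≤ (D.bind ends).count (some v) ∧ (D.bind ends).count (some v) ≤ 2 := by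
  induction n using Nat.strong_induction_on with
  | _ n ih =>
  intro U M x hcard hx hM hd hU
  by_cases hxM : ∃ e ∈ M, x ∈ e
  · obtain ⟨e, he, y, rfl⟩ := hxM
    have hxy : x ≠ y := by simpa using hd _ he
    have hy : y ∈ U := hU _ he y (by simp)
    obtain ⟨M, rfl⟩ := Multiset.exists_cons_of_mem he
    obtain ⟨D, hD, rfl, hout, h1, h2⟩ := ih (M.card + U.card) (by simp at hcard; omega) U M y rfl hy
      (Multiset.nodup_cons.1 hM).2 (fun e h => hd e (by simp [h])) (fun e h => hU e (by simp [h]))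
    rw [Sym2.eq_swap] at hM hd hU ⊢
    obtain ⟨D', hD', hE', hN'⟩ := exists_add_edge hD hM hd fun w hw =>
      Multiset.one_le_count_iff_mem.1 (h2 w (hU _ hw w (by simp)) fun e => hd _ hw (by simp [e])).1
    have hc : ∀ v, (D'.bind ends).count (some v) + (if v = x then 1 else 0) =
        (D.bind ends).count (some v) + (if v = y then 1 else 0) := by
      intro v
      have := congrArg (Multiset.count (some v)) hN'
      simpa [Multiset.count_add, Multiset.count_singleton] using this
    refine ⟨D', hD', by rw [hE', add_comm, Multiset.singleton_add], ?_, ?_, ?_⟩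
    · intro v hv
      have h3 := hc v
      rw [if_neg (by rintro rfl; exact hv hx), if_neg (by rintro rfl; exact hv hy), hout v hv] at h3
      simpa using h3
    · have h3 := hc x
      have h4 := h2 x hx hxy
      simp [hxy] at h3
      omega
    · intro v hv hvx
      have h3 := hc v
      by_cases hvy : v = y
      · subst hvy
        simp [hvx] at h3
        omega
      · have := h2 v hv hvy
        simp [hvx, hvy] at h3
        omega
  · push Not at hxM
    rcases (U.erase x).eq_empty_or_nonempty with hE | ⟨w, hw⟩
    · have hUx : ∀ v ∈ U, v = x := fun v hv => by
        by_contra h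
        have : v ∈ U.erase x := by simp [h, hv]
        simp [hE] at this
      refine ⟨0, by simp [Good], ?_, by simp, by simp, fun v hv hvx => absurd (hUx v hv) hvx⟩
      rw [Multiset.zero_bind, eq_comm]
      refine Multiset.eq_zero_of_forall_notMem fun e he => ?_
      have h3 := hU e he e.out.1 (Sym2.out_fst_mem e)
      exact hxM e he (hUx _ h3 ▸ Sym2.out_fst_mem e)
    · have hwU := Finset.mem_of_mem_erase hw
      have hwx := Finset.ne_of_mem_erase hw
      have hc := Finset.card_erase_add_one hx
      obtain ⟨D, hD, rfl, hout, h1, h2⟩ := ih (M.card + (U.erase x).card) (by omega) (U.erase x) M w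
        rfl hw hM hd (fun e he v hv => Finset.mem_erase.2
          ⟨by rintro rfl; exact hxM e he hv, hU e he v hv⟩)
      by_cases h0 : (D.bind ends).count (some w) = 0
      · have hc : ∀ v, (([w] ::ₘ D).bind ends).count (some v) =
            (D.bind ends).count (some v) + (if v = w then 2 else 0) := by
          intro v
          by_cases h : v = w
          · subst h; simp [ends, h0]
          · simp [ends, h]
        refine ⟨[w] ::ₘ D, good_cons (by simp) (by simp) hD, by simp [edg], ?_, ?_, ?_⟩
        · intro v hv
          rw [hc, hout v (by simp [hv]), if_neg (by rintro rfl; exact hv hwU)]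
        · rw [hc, hout x (by simp), if_neg hwx.symm]; simp
        · intro v hv hvx
          rw [hc]
          by_cases h : v = w
          · subst h; simp [h0]
          · simpa [h] using h2 v (by simp [hv, hvx]) h
      · refine ⟨D, hD, rfl, fun v hv => hout v (by simp [hv]), by simp [hout x], ?_⟩
        intro v hv hvx
        by_cases h : v = w
        · subst h; omega
        · exact h2 v (by simp [hv, hvx]) h

end Flags

lemma mem_ends_of_mem_head {D : Multiset (List V)} {x} (h : x ∈ D.map List.head?) :
    x ∈ D.bind ends := by
  obtain ⟨l, hl, rfl⟩ := Multiset.mem_map.1 h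
  exact Multiset.mem_bind.2 ⟨l, hl, by simp [ends]⟩

lemma mem_ends_of_mem_last {D : Multiset (List V)} {x} (h : x ∈ D.map List.getLast?) :
    x ∈ D.bind ends := by
  obtain ⟨l, hl, rfl⟩ := Multiset.mem_map.1 h
  exact Multiset.mem_bind.2 ⟨l, hl, by simp [ends]⟩

section Orientation

variable [DecidableEq V]

lemma exists_of_mem_ends {D : Multiset (List V)} (hD : Good D) {a : V}
    (ha : some a ∈ D.bind ends) :
    ∃ (l : List V) (D₀ : Multiset (List V)) (z : V), l.head? = some a ∧ l.getLast? = some z ∧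
      l.Nodup ∧ l ≠ [] ∧ Good D₀ ∧ D.card = D₀.card + 1 ∧
      D.bind edg = edg l + D₀.bind edg ∧ D.bind ends = some a ::ₘ some z ::ₘ D₀.bind ends := by
  rw [← bind_flags_fst a] at ha
  obtain ⟨f, hf, hfa⟩ := Multiset.mem_map.1 ha
  obtain ⟨l, D₀, hfl, hn, h0, hD₀, hc, hE, hN, -⟩ := exists_of_mem_flags hD hf
  have hla : l.head? = some a := by rw [← hfa, ← hfl, flag]
  obtain ⟨z, hz⟩ := Option.isSome_iff_exists.1 (List.getLast?_isSome.2 h0)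
  refine ⟨l, D₀, z, hla, hz, hn, h0, hD₀, hc, hE, ?_⟩
  rw [hN, ends, hz, hla]
  simp

lemma exists_orientation_aux (n : ℕ) : ∀ (R : Multiset (List V)) (b a : V), R.card = n →
    Good R → (∀ v, (some b ::ₘ some a ::ₘ R.bind ends).count (some v) ≤ 2) →
    ∃ R', Good R' ∧ R'.bind edg = R.bind edg ∧ R'.bind ends = R.bind ends ∧
      (some b ::ₘ R'.map List.head?).Nodup ∧ (some a ::ₘ R'.map List.getLast?).Nodup := by
  induction n with
  | zero =>
    intro R b a hn hR hc
    obtain rfl := Multiset.card_eq_zero.1 hn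
    exact ⟨0, hR, by simp⟩
  | succ n ih =>
    intro R b a hn hR hc
    have key : ∀ {x y z : V} {S : Multiset (Option V)},
        (some x ::ₘ some y ::ₘ some y ::ₘ some z ::ₘ S).count (some y) ≤ 2 →
        x ≠ y ∧ z ≠ y ∧ some y ∉ S := by
      intro x y z S h
      simp only [Multiset.count_cons, Option.some.injEq] at h
      refine ⟨?_, ?_, fun h' => ?_⟩
      · rintro rfl; simp at h
      · rintro rfl; simp at h; omega
      · have := Multiset.one_le_count_iff_mem.2 h'
        simp at h; omega
    by_cases ha : some a ∈ R.bind ends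
    · obtain ⟨l, R₀, z, hh, hz, hln, hl0, hR₀, hcard, hE, hN⟩ := exists_of_mem_ends hR ha
      obtain ⟨R', hR', hE', hN', h1, h2⟩ := ih R₀ b z (by omega) hR₀ fun v => by
        refine le_trans (Multiset.count_le_of_le _ ?_) (hc v)
        rw [hN]
        exact Multiset.cons_le_cons _ ((Multiset.le_cons_self _ _).trans
          (Multiset.le_cons_self _ _))
      have hca := hc a
      rw [hN] at hca
      obtain ⟨hba, hza, haR⟩ := key hca
      refine ⟨l ::ₘ R', good_cons hln hl0 hR', by simp [hE, hE'], ?_, ?_, ?_⟩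
      · rw [hN, Multiset.cons_bind, hN', ends, hh, hz]; simp
      · rw [Multiset.map_cons, hh, Multiset.cons_swap]
        refine Multiset.nodup_cons.2 ⟨?_, h1⟩
        intro h
        rcases Multiset.mem_cons.1 h with h | h
        · exact hba (Option.some.inj h).symm
        · exact haR (hN' ▸ mem_ends_of_mem_head h)
      · rw [Multiset.map_cons, hz]
        refine Multiset.nodup_cons.2 ⟨?_, h2⟩
        intro h
        rcases Multiset.mem_cons.1 h with h | h
        · exact hza (Option.some.inj h).symm
        · exact haR (hN' ▸ mem_ends_of_mem_last h)
    by_cases hb : some b ∈ R.bind ends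
    · obtain ⟨l, R₀, z, hh, hz, hln, hl0, hR₀, hcard, hE, hN⟩ := exists_of_mem_ends hR hb
      obtain ⟨R', hR', hE', hN', h1, h2⟩ := ih R₀ z a (by omega) hR₀ fun v => by
        refine le_trans (Multiset.count_le_of_le _ ?_) (hc v)
        rw [hN, Multiset.cons_swap (some z)]
        refine le_trans ?_ (Multiset.le_cons_self _ _)
        exact Multiset.cons_le_cons _ (Multiset.le_cons_self _ _)
      have hcb := hc b
      rw [hN, Multiset.cons_swap (some b)] at hcb
      obtain ⟨hab, hzb, hbR⟩ := key hcb
      refine ⟨l.reverse ::ₘ R', good_cons (List.nodup_reverse.2 hln) (by simpa using hl0) hR',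
        by simp [hE, hE', edg_reverse], ?_, ?_, ?_⟩
      · rw [hN, Multiset.cons_bind, hN', ends_reverse, ends, hh, hz]; simp
      · rw [Multiset.map_cons, List.head?_reverse, hz]
        refine Multiset.nodup_cons.2 ⟨?_, h1⟩
        intro h
        rcases Multiset.mem_cons.1 h with h | h
        · exact hzb (Option.some.inj h).symm
        · exact hbR (hN' ▸ mem_ends_of_mem_head h)
      · rw [Multiset.map_cons, List.getLast?_reverse, hh, Multiset.cons_swap]
        refine Multiset.nodup_cons.2 ⟨?_, h2⟩
        intro h
        rcases Multiset.mem_cons.1 h with h | h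
        · exact hab (Option.some.inj h).symm
        · exact hbR (hN' ▸ mem_ends_of_mem_last h)
    · obtain ⟨k, hk⟩ := Multiset.card_pos_iff_exists_mem.1 (by omega : 0 < R.card)
      obtain ⟨u, hu⟩ := Option.isSome_iff_exists.1 (List.isSome_head?.2 (hR k hk).2)
      obtain ⟨l, R₀, z, hh, hz, hln, hl0, hR₀, hcard, hE, hN⟩ := exists_of_mem_ends hR (a := u)
        (Multiset.mem_bind.2 ⟨k, hk, by simp [ends, hu]⟩)
      obtain ⟨R', hR', hE', hN', h1, h2⟩ := ih R₀ u z (by omega) hR₀ fun v => by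
        refine le_trans (Multiset.count_le_of_le _ ?_) (hc v)
        rw [hN]
        exact (Multiset.le_cons_self _ _).trans (Multiset.le_cons_self _ _)
      have hN'' : (l ::ₘ R').bind ends = R.bind ends := by
        rw [hN, Multiset.cons_bind, hN', ends, hh, hz]; simp
      refine ⟨l ::ₘ R', good_cons hln hl0 hR', by simp [hE, hE'], hN'',
        Multiset.nodup_cons.2 ⟨fun h => hb (hN'' ▸ mem_ends_of_mem_head h), ?_⟩,
        Multiset.nodup_cons.2 ⟨fun h => ha (hN'' ▸ mem_ends_of_mem_last h), ?_⟩⟩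
      · rwa [Multiset.map_cons, hh]
      · rwa [Multiset.map_cons, hz]

/-- A collection of paths such that every vertex is an end of at most two of them can be
oriented with distinct starting points and distinct final points. -/
lemma exists_orientation {R : Multiset (List V)} (hR : Good R)
    (hc : ∀ v, (R.bind ends).count (some v) ≤ 2) :
    ∃ R', Good R' ∧ R'.bind edg = R.bind edg ∧ R'.bind ends = R.bind ends ∧
      (R'.map List.head?).Nodup ∧ (R'.map List.getLast?).Nodup := by
  rcases R.empty_or_exists_mem with rfl | ⟨l, hl⟩
  · exact ⟨0, hR, by simp⟩
  obtain ⟨R, rfl⟩ := Multiset.exists_cons_of_mem hl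
  have hl0 := (hR l hl).2
  obtain ⟨u, hu⟩ := Option.isSome_iff_exists.1 (List.isSome_head?.2 hl0)
  obtain ⟨z, hz⟩ := Option.isSome_iff_exists.1 (List.getLast?_isSome.2 hl0)
  have hN : (l ::ₘ R).bind ends = some u ::ₘ some z ::ₘ R.bind ends := by
    rw [Multiset.cons_bind, ends, hu, hz]; simp
  obtain ⟨R', hR', hE', hN', h1, h2⟩ := exists_orientation_aux _ R u z rfl
    (fun k hk => hR k (Multiset.mem_cons_of_mem hk)) (by rwa [← hN])
  exact ⟨l ::ₘ R', good_cons (hR l hl).1 hl0 hR', by simp [hE'], by simp [hN'],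
    by rwa [Multiset.map_cons, hu], by rwa [Multiset.map_cons, hz]⟩

/-- Every graph decomposes into oriented paths with distinct starting points and distinct final
points, such that each vertex is an end of some path. -/
lemma exists_oriented_decomp [Fintype V] [Nonempty V] (H : SimpleGraph V) :
    ∃ D : Multiset (List V), Good D ∧ (D.bind edg).Nodup ∧ (∀ e, e ∈ D.bind edg ↔ e ∈ H.edgeSet) ∧
      (D.map List.head?).Nodup ∧ (D.map List.getLast?).Nodup ∧
      ∀ v, some v ∈ D.map List.head? ∨ some v ∈ D.map List.getLast? := by
  classical
  obtain ⟨x⟩ := ‹Nonempty V›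
  obtain ⟨D, hD, hE, -, h1, h2⟩ := exists_decomp_aux _ Finset.univ H.edgeFinset.val x rfl
    (Finset.mem_univ _) H.edgeFinset.nodup
    (fun e he => H.not_isDiag_of_mem_edgeSet (by simpa using he)) (by simp)
  obtain ⟨R, hR, hRE, hc⟩ : ∃ R, Good R ∧ R.bind edg = D.bind edg ∧
      ∀ v, 1 ≤ (R.bind ends).count (some v) ∧ (R.bind ends).count (some v) ≤ 2 := by
    by_cases h0 : (D.bind ends).count (some x) = 0
    · refine ⟨[x] ::ₘ D, good_cons (by simp) (by simp) hD, by simp [edg], fun v => ?_⟩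
      by_cases h : v = x
      · subst h; simp [ends, h0]
      · simpa [ends, h] using h2 v (Finset.mem_univ _) h
    · refine ⟨D, hD, rfl, fun v => ?_⟩
      by_cases h : v = x
      · subst h; omega
      · exact h2 v (Finset.mem_univ _) h
  obtain ⟨R', hR', hE', hN', h3, h4⟩ := exists_orientation hR fun v => (hc v).2
  rw [hRE, hE] at hE'
  refine ⟨R', hR', by rw [hE']; exact Finset.nodup _, by simp [hE'], h3, h4, fun v => ?_⟩
  have := Multiset.one_le_count_iff_mem.1 (hc v).1
  rw [← hN'] at this
  obtain ⟨l, hl, hv⟩ := Multiset.mem_bind.1 this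
  rw [ends, Multiset.insert_eq_cons, Multiset.mem_cons, Multiset.mem_singleton] at hv
  exact hv.imp (fun h => Multiset.mem_map.2 ⟨l, hl, h.symm⟩)
    (fun h => Multiset.mem_map.2 ⟨l, hl, h.symm⟩)

end Orientation

lemma exists_walk (G : SimpleGraph V) (l : List V) : ∀ a : V, (∀ e ∈ edg (a :: l), e ∈ G.edgeSet) →
    ∃ v, ∃ p : G.Walk a v, p.support = a :: l ∧ (p.edges : Multiset (Sym2 V)) = edg (a :: l) := by
  induction l with
  | nil => exact fun a _ => ⟨a, .nil, by simp [edg]⟩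
  | cons b l ih =>
    intro a h
    obtain ⟨v, p, hs, he⟩ := ih b fun e he => h e (by simp [edg, he])
    have hab : G.Adj a b := h s(a, b) (by simp [edg])
    exact ⟨v, .cons hab p, by simp [hs], by simp [edg, ← he]⟩

lemma exists_isPathDecomp (G : SimpleGraph V) (L : Multiset (List V)) (hL : Good L)
    (hn : (L.bind edg).Nodup) (hE : ∀ e, e ∈ L.bind edg ↔ e ∈ G.edgeSet) :
    ∃ P, G.IsPathDecomp P ∧ P.length = L.card := by
  suffices h : ∀ L : Multiset (List V), Good L → (L.bind edg).Nodup →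
      (∀ e ∈ L.bind edg, e ∈ G.edgeSet) → ∃ P : List (Σ u v : V, G.Walk u v),
        P.length = L.card ∧ (∀ p ∈ P, p.2.2.IsPath) ∧
        P.Pairwise (fun p q => ∀ e ∈ p.2.2.edges, e ∉ q.2.2.edges) ∧
        ∀ e, e ∈ L.bind edg ↔ ∃ p ∈ P, e ∈ p.2.2.edges by
    obtain ⟨P, hc, h1, h2, h3⟩ := h L hL hn fun e he => (hE e).1 he
    exact ⟨P, ⟨h1, h2, fun e he => (h3 e).1 ((hE e).2 he)⟩, hc⟩
  intro L
  induction L using Multiset.induction with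
  | empty => exact fun _ _ _ => ⟨[], by simp⟩
  | cons l L ih =>
    intro hL hn hE
    rw [Multiset.cons_bind] at hn hE
    obtain ⟨hn1, hn2, hdis⟩ := Multiset.nodup_add.1 hn
    obtain ⟨P, hc, h1, h2, h3⟩ := ih (fun k hk => hL k (Multiset.mem_cons_of_mem hk)) hn2
      fun e he => hE e (by simp [he])
    obtain ⟨hl, hl0⟩ := hL l (Multiset.mem_cons_self _ _)
    obtain ⟨a, l, rfl⟩ := List.exists_cons_of_ne_nil hl0
    obtain ⟨v, p, hs, he⟩ := exists_walk G l a fun e he => hE e (by simp [he])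
    have hpe : ∀ e, e ∈ p.edges ↔ e ∈ edg (a :: l) := fun e => by rw [← he]; simp
    refine ⟨⟨a, v, p⟩ :: P, by simp [hc], ?_, ?_, ?_⟩
    · intro q hq
      rcases List.mem_cons.1 hq with rfl | hq
      · exact (Walk.isPath_def _).2 (by rw [hs]; exact hl)
      · exact h1 q hq
    · refine List.pairwise_cons.2 ⟨fun q hq e he heq => ?_, h2⟩
      exact Multiset.disjoint_left.1 hdis ((hpe e).1 he) ((h3 e).2 ⟨q, hq, heq⟩)
    · intro e
      rw [Multiset.cons_bind, Multiset.mem_add, h3, ← hpe]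
      simp

section Layers

variable {W : Type*} {m : ℕ} (H : SimpleGraph W)

lemma mem_edgeSet_layer_zero (hm : 0 < m) (e : Sym2 (Fin m × W)) :
    (e ∈ (pathGraph m □ H).edgeSet ∧ ∀ x ∈ e, x.1.val ≤ 0) ↔
      ∃ f ∈ H.edgeSet, Sym2.map (Prod.mk (⟨0, hm⟩ : Fin m)) f = e := by
  induction e with | _ x y
  obtain ⟨⟨p, hp⟩, u⟩ := x
  obtain ⟨⟨q, hq⟩, v⟩ := y
  simp only [mem_edgeSet, boxProd_adj, pathGraph_adj, Sym2.mem_iff, forall_eq_or_imp, forall_eq]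
  constructor
  · rintro ⟨h, h1, h2⟩
    obtain rfl : p = 0 := by omega
    obtain rfl : q = 0 := by omega
    exact ⟨s(u, v), by simpa using h, by simp⟩
  · rintro ⟨f, hf, h⟩
    induction f with | _ a b
    simp only [Sym2.map_mk, Sym2.eq_iff, Prod.mk.injEq, Fin.mk.injEq] at h
    rw [mem_edgeSet] at hf
    rcases h with ⟨⟨rfl, rfl⟩, rfl, rfl⟩ | ⟨⟨rfl, rfl⟩, rfl, rfl⟩
    · simp [hf]
    · simp [hf.symm]

lemma mem_edgeSet_layer_succ {i : ℕ} (hi : i + 1 < m) (e : Sym2 (Fin m × W)) :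
    (e ∈ (pathGraph m □ H).edgeSet ∧ ∀ x ∈ e, x.1.val ≤ i + 1) ↔
      ((e ∈ (pathGraph m □ H).edgeSet ∧ ∀ x ∈ e, x.1.val ≤ i) ∨
      (∃ w, s(((⟨i, by omega⟩ : Fin m), w), ((⟨i + 1, hi⟩ : Fin m), w)) = e)) ∨
      ∃ f ∈ H.edgeSet, Sym2.map (Prod.mk (⟨i + 1, hi⟩ : Fin m)) f = e := by
  induction e with | _ x y
  obtain ⟨⟨p, hp⟩, u⟩ := x
  obtain ⟨⟨q, hq⟩, v⟩ := y
  simp only [mem_edgeSet, boxProd_adj, pathGraph_adj, Sym2.mem_iff, forall_eq_or_imp, forall_eq]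
  constructor
  · rintro ⟨h, h1, h2⟩
    by_cases h3 : p ≤ i ∧ q ≤ i
    · exact Or.inl (Or.inl ⟨h, h3⟩)
    · rcases h with ⟨h, rfl⟩ | ⟨h, h'⟩
      · refine Or.inl (Or.inr ⟨u, ?_⟩)
        rcases h with h | h
        · obtain rfl : p = i := by omega
          obtain rfl : q = p + 1 := by omega
          rfl
        · obtain rfl : q = i := by omega
          obtain rfl : p = q + 1 := by omega
          exact Sym2.eq_swap
      · rw [Fin.mk.injEq] at h'
        subst h'
        obtain rfl : p = i + 1 := by omega
        exact Or.inr ⟨s(u, v), h, by simp⟩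
  · rintro ((⟨h, h1, h2⟩ | ⟨w, h⟩) | ⟨f, hf, h⟩)
    · exact ⟨h, by omega, by omega⟩
    · simp only [Sym2.eq_iff, Prod.mk.injEq, Fin.mk.injEq] at h
      rcases h with ⟨⟨rfl, rfl⟩, rfl, rfl⟩ | ⟨⟨rfl, rfl⟩, rfl, rfl⟩ <;> simp
    · induction f with | _ a b
      simp only [Sym2.map_mk, Sym2.eq_iff, Prod.mk.injEq, Fin.mk.injEq] at h
      rw [mem_edgeSet] at hf
      rcases h with ⟨⟨rfl, rfl⟩, rfl, rfl⟩ | ⟨⟨rfl, rfl⟩, rfl, rfl⟩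
      · simp [hf]
      · simp [hf.symm]

lemma exists_layers [Fintype W] {ι : Type*} [Fintype ι] {d : ι → List W}
    (hd : ∀ j, (d j).Nodup) {s t : ι → W} (hs : ∀ j, (d j).head? = some (s j))
    (ht : ∀ j, (d j).getLast? = some (t j)) (hsi : s.Injective) (hti : t.Injective)
    (hn : (∑ j, edg (d j)).Nodup) (hE : ∀ e, e ∈ ∑ j, edg (d j) ↔ e ∈ H.edgeSet) (i : ℕ) :
    ∀ hi : i < m, ∃ (I : Multiset (List (Fin m × W))) (Q : ι → List (Fin m × W)), Good I ∧
      (∀ j, (Q j).Nodup ∧ (Q j).getLast? = some (⟨i, hi⟩, t j) ∧ ∀ x ∈ Q j, x.1.val ≤ i) ∧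
      (∀ l ∈ I, ∀ x ∈ l, x.1.val ≤ i) ∧
      (I.bind edg + ∑ j, edg (Q j)).Nodup ∧
      (∀ e, e ∈ I.bind edg + ∑ j, edg (Q j) ↔
        e ∈ (pathGraph m □ H).edgeSet ∧ ∀ x ∈ e, x.1.val ≤ i) ∧
      I.card + i * Fintype.card ι = i * Fintype.card W := by
  classical
  have hinj : ∀ k : Fin m, Function.Injective (Prod.mk k : W → Fin m × W) :=
    fun k a b h => (Prod.mk.inj h).2
  have hlay : ∀ k : Fin m, ∑ j, edg ((d j).map (Prod.mk k)) =
      (∑ j, edg (d j)).map (Sym2.map (Prod.mk k)) := by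
    intro k
    simp only [edg_map]
    exact (map_sum (Multiset.mapAddMonoidHom (Sym2.map (Prod.mk k))) _ _).symm
  induction i with
  | zero =>
    intro hi
    refine ⟨0, fun j => (d j).map (Prod.mk ⟨0, hi⟩), by simp [Good], fun j =>
      ⟨(hd j).map (hinj _), by simp [ht], by simp⟩, by simp, ?_, ?_, by simp⟩
    · rw [Multiset.zero_bind, zero_add, hlay]
      exact hn.map (Sym2.map.injective (hinj _))
    · intro e
      rw [Multiset.zero_bind, zero_add, hlay, mem_edgeSet_layer_zero H hi]
      simp only [Multiset.mem_map, hE]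
  | succ i ih =>
    intro hi
    obtain ⟨I, Q, hI, hQ, hIi, hnd, hmem, hcard⟩ := ih (by omega)
    set k : Fin m := ⟨i, by omega⟩ with hk
    set k' : Fin m := ⟨i + 1, hi⟩ with hk'
    let B : W → List (Fin m × W) := Function.extend t Q fun v => [(k, v)]
    have hBt : ∀ j, B (t j) = Q j := fun j => hti.extend_apply _ _ _
    have hBn : ∀ v, v ∉ Set.range t → B v = [(k, v)] := fun v hv =>
      Function.extend_apply' _ _ _ hv
    have hB : ∀ v, (B v).Nodup ∧ (B v).getLast? = some (k, v) ∧ ∀ x ∈ B v, x.1.val ≤ i := by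
      intro v
      by_cases hv : v ∈ Set.range t
      · obtain ⟨j, rfl⟩ := hv
        rw [hBt]; exact hQ j
      · rw [hBn v hv]; simp [hk]
    have hBP : ∀ v, edg (B v ++ [(k', v)]) = edg (B v) + {s((k, v), (k', v))} := by
      intro v
      obtain ⟨b, hb⟩ := List.getLast?_eq_some_iff.1 (hB v).2.1
      rw [hb, List.append_assoc]
      exact edg_append_pair _ _ _
    have hQ' : ∀ j, edg (B (s j) ++ (d j).map (Prod.mk k')) =
        edg (B (s j) ++ [(k', s j)]) + edg ((d j).map (Prod.mk k')) := by
      intro j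
      obtain ⟨b, hb⟩ := List.head?_eq_some_iff.1 (hs j)
      rw [hb, List.map_cons, edg_append_cons]
    have hsumB : ∑ v, edg (B v) = ∑ j, edg (Q j) :=
      (Fintype.sum_of_injective t hti _ _ (fun v hv => by rw [hBn v hv, edg])
        fun j => by rw [hBt]).symm
    let C : Finset W := (Finset.univ.image s)ᶜ
    have hCcard : C.card + Fintype.card ι = Fintype.card W := by
      have := Finset.card_compl_add_card (Finset.univ.image s)
      rwa [Finset.card_image_of_injective _ hsi, Finset.card_univ] at this
    have hsumP : ∑ v ∈ C, edg (B v ++ [(k', v)]) + ∑ j, edg (B (s j) ++ [(k', s j)]) =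
        ∑ j, edg (Q j) + ∑ v, {s((k, v), (k', v))} := by
      rw [← hsumB, ← Finset.sum_add_distrib, ← Finset.sum_compl_add_sum (Finset.univ.image s),
        Finset.sum_image (fun a _ b _ h => hsi h)]
      simp only [hBP, C]
    let V : Multiset (Sym2 (Fin m × W)) := Finset.univ.val.map fun v => s((k, v), (k', v))
    have hV : ∑ v : W, {s((k, v), (k', v))} = V := by
      conv_rhs => rw [← Multiset.sum_map_singleton V, Multiset.map_map]
      rfl
    have htot : (I + C.val.map fun v => B v ++ [(k', v)]).bind edg +
        ∑ j, edg (B (s j) ++ (d j).map (Prod.mk k')) =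
        I.bind edg + ∑ j, edg (Q j) + V + (∑ j, edg (d j)).map (Sym2.map (Prod.mk k')) := by
      have h1 : (C.val.map fun v => B v ++ [(k', v)]).bind edg =
          ∑ v ∈ C, edg (B v ++ [(k', v)]) := by
        rw [Multiset.bind_map]; rfl
      simp only [hQ', Finset.sum_add_distrib, Multiset.add_bind, h1, hlay]
      rw [add_assoc, ← add_assoc (∑ v ∈ C, _), hsumP, hV]
      simp only [add_assoc]
    have hnk : ∀ {v : W} {x : Fin m × W}, x.1.val ≤ i → x ≠ (k', v) := by
      rintro v x hx rfl
      simp [hk'] at hx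
    refine ⟨I + C.val.map fun v => B v ++ [(k', v)], fun j => B (s j) ++ (d j).map (Prod.mk k'),
      ?_, ?_, ?_, ?_, ?_, ?_⟩
    · intro l hl
      rcases Multiset.mem_add.1 hl with hl | hl
      · exact hI l hl
      · obtain ⟨v, -, rfl⟩ := Multiset.mem_map.1 hl
        refine ⟨List.nodup_append.2 ⟨(hB v).1, by simp, ?_⟩, by simp⟩
        intro x hx y hy
        rw [List.mem_singleton.1 hy]
        exact hnk ((hB v).2.2 x hx)
    · intro j
      refine ⟨List.nodup_append.2 ⟨(hB _).1, (hd j).map (hinj _), ?_⟩, by simp [ht], ?_⟩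
      · intro x hx y hy
        obtain ⟨v, -, rfl⟩ := List.mem_map.1 hy
        exact hnk ((hB _).2.2 x hx)
      · intro x hx
        rcases List.mem_append.1 hx with hx | hx
        · exact ((hB _).2.2 x hx).trans (Nat.le_succ _)
        · obtain ⟨v, -, rfl⟩ := List.mem_map.1 hx
          simp [hk']
    · intro l hl x hx
      rcases Multiset.mem_add.1 hl with hl | hl
      · exact (hIi l hl x hx).trans (Nat.le_succ _)
      · obtain ⟨v, -, rfl⟩ := Multiset.mem_map.1 hl
        rcases List.mem_append.1 hx with hx | hx
        · exact ((hB _).2.2 x hx).trans (Nat.le_succ _)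
        · simp [List.mem_singleton.1 hx, hk']
    · rw [htot]
      have hkk : k ≠ k' := by simp [hk, hk']
      refine Multiset.nodup_add.2 ⟨Multiset.nodup_add.2 ⟨hnd, ?_, ?_⟩,
        hn.map (Sym2.map.injective (hinj _)), ?_⟩
      · refine Finset.univ.nodup.map fun a b h => ?_
        simpa [hkk] using h
      · rw [Multiset.disjoint_left]
        intro e he he'
        obtain ⟨v, -, rfl⟩ := Multiset.mem_map.1 he'
        exact hnk (v := v) (((hmem _).1 he).2 (k', v) (by simp)) rfl
      · rw [Multiset.disjoint_left]
        intro e he he'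
        obtain ⟨f, -, rfl⟩ := Multiset.mem_map.1 he'
        induction f with | _ a b
        rcases Multiset.mem_add.1 he with he | he
        · exact hnk (v := a) (((hmem _).1 he).2 (k', a) (by simp)) rfl
        · obtain ⟨v, -, h⟩ := Multiset.mem_map.1 he
          simp [hkk] at h
    · intro e
      rw [htot, mem_edgeSet_layer_succ H hi, Multiset.mem_add, Multiset.mem_add, hmem]
      simp [V, hE, hk, hk']
    · rw [Multiset.card_add, Multiset.card_map, Finset.card_val, add_mul, add_mul, ← hcard,
        ← hCcard]
      ring

end Layers

end PathDecomp

/-- Gallai's conjecture holds for `P_m □ H`, `H` connected: `p(P_m □ H) ≤ m * n / 2`. -/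
theorem pathNumber_pathGraph_boxProd_le {W : Type*} [Fintype W] (m : ℕ) (hm : 2 ≤ m)
    (H : SimpleGraph W) (hH : H.Connected) :
    2 * (pathGraph m □ H).pathNumber ≤ m * Fintype.card W := by
  classical
  have := hH.nonempty
  obtain ⟨D, hD, hDn, hDE, hh, hl, hcov⟩ := PathDecomp.exists_oriented_decomp H
  have hhi := Multiset.inj_on_of_nodup_map hh
  have hli := Multiset.inj_on_of_nodup_map hl
  let S : Finset (List W) := ⟨D, hh.of_map _⟩
  have hS : ∀ l : S, l.1 ∈ D := fun l => l.2
  choose s hs using fun l : S => Option.isSome_iff_exists.1 (List.isSome_head?.2 (hD l (hS l)).2)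
  choose t ht using fun l : S =>
    Option.isSome_iff_exists.1 (List.getLast?_isSome.2 (hD l (hS l)).2)
  have hsi : s.Injective := fun a b h =>
    Subtype.ext (hhi _ (hS a) _ (hS b) (by rw [hs, hs, h]))
  have hti : t.Injective := fun a b h =>
    Subtype.ext (hli _ (hS a) _ (hS b) (by rw [ht, ht, h]))
  have hsum : ∑ l : S, PathDecomp.edg l.1 = D.bind PathDecomp.edg :=
    Finset.sum_coe_sort S PathDecomp.edg
  obtain ⟨I, Q, hI, hQ, -, hn, hE, hc⟩ := PathDecomp.exists_layers (m := m) H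
    (fun l : S => (hD l (hS l)).1) hs ht hsi hti (by rwa [hsum]) (by rwa [hsum]) (m - 1) (by omega)
  have hbind : (I + Finset.univ.val.map Q).bind PathDecomp.edg =
      I.bind PathDecomp.edg + ∑ j, PathDecomp.edg (Q j) := by
    rw [Multiset.add_bind, Multiset.bind_map]; rfl
  obtain ⟨P, hP, hPl⟩ := PathDecomp.exists_isPathDecomp (pathGraph m □ H)
    (I + Finset.univ.val.map Q) (by
      intro l hl
      rcases Multiset.mem_add.1 hl with hl | hl
      · exact hI l hl
      · obtain ⟨j, -, rfl⟩ := Multiset.mem_map.1 hl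
        refine ⟨(hQ j).1, fun h => ?_⟩
        have := (hQ j).2.1
        simp [h] at this) (by rwa [hbind]) (fun e => by
      rw [hbind, hE]
      exact and_iff_left fun x _ => Nat.le_sub_one_of_lt x.1.2)
  have hle : (pathGraph m □ H).pathNumber ≤ P.length := Nat.sInf_le ⟨P, hP, rfl⟩
  have hcard : Fintype.card W ≤ 2 * Fintype.card S := by
    have hsub : (Finset.univ : Finset W) ⊆ Finset.univ.image s ∪ Finset.univ.image t := by
      intro v _
      rw [Finset.mem_union]
      refine (hcov v).imp (fun h => ?_) fun h => ?_
      · obtain ⟨l, hl, h⟩ := Multiset.mem_map.1 h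
        exact Finset.mem_image.2 ⟨⟨l, hl⟩, Finset.mem_univ _,
          Option.some.inj ((hs ⟨l, hl⟩).symm.trans h)⟩
      · obtain ⟨l, hl, h⟩ := Multiset.mem_map.1 h
        exact Finset.mem_image.2 ⟨⟨l, hl⟩, Finset.mem_univ _,
          Option.some.inj ((ht ⟨l, hl⟩).symm.trans h)⟩
    have h1 := Finset.card_le_card hsub
    have h2 := Finset.card_union_le (Finset.univ.image s) (Finset.univ.image t)
    rw [Finset.card_image_of_injective _ hsi, Finset.card_image_of_injective _ hti] at h2
    simp only [Finset.card_univ] at h1 h2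
    omega
  rw [Multiset.card_add, Multiset.card_map, Finset.card_val, Finset.card_univ] at hPl
  obtain ⟨r, rfl⟩ := Nat.exists_eq_add_of_le' hm
  rw [show r + 2 - 1 = r + 1 from rfl] at hc
  nlinarith [Nat.mul_le_mul_left r hcard]
end

section
/- Let G be a connected simple graph of order m ≥ 2 and H a connected simple graph of order n. If p(G) = n_o(G)/2, where n_o(G) is the number of vertices of odd degree in G, then p(G □ H) ≤ mn/2. -/
open SimpleGraph

/-- `n_o(G)`: the number of vertices of `G` of odd degree. -/
def SimpleGraph.oddCount {V : Type*} [Fintype V] (G : SimpleGraph V)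
    [DecidableRel G.Adj] : ℕ :=
  (Finset.univ.filter fun v => Odd (G.degree v)).card

/-- The edges of the walk visiting the vertices of a list in order, with multiplicity. -/
def pathEdges {V : Type*} : List V → Multiset (Sym2 V)
  | [] => 0
  | [_] => 0
  | a :: b :: l => s(a, b) ::ₘ pathEdges (b :: l)

/-- The two ends of the walk visiting the vertices of a nonempty list in order. -/
def pathEnds {V : Type*} : List V → Multiset V
  | [] => 0
  | a :: l => {a, l.getLastD a}

section
variable {V W ι : Type*}

@[simp] theorem pathEdges_nil : pathEdges ([] : List V) = 0 := rfl
@[simp] theorem pathEdges_singleton (a : V) : pathEdges [a] = 0 := rfl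
@[simp] theorem pathEdges_cons_cons (a b : V) (l : List V) :
    pathEdges (a :: b :: l) = s(a, b) ::ₘ pathEdges (b :: l) := rfl

theorem pathEdges_append_cons (l : List V) (a : V) (m : List V) :
    pathEdges (l ++ a :: m) = pathEdges (l ++ [a]) + pathEdges (a :: m) := by
  induction l with
  | nil => simp
  | cons b l ih =>
    cases l with
    | nil => simp
    | cons c l => simpa using ih

theorem pathEdges_reverse (l : List V) : pathEdges l.reverse = pathEdges l := by
  induction l with
  | nil => rfl
  | cons a l ih =>
    cases l with
    | nil => rfl
    | cons b l =>
      rw [List.reverse_cons, List.reverse_cons, List.append_assoc, List.singleton_append,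
        pathEdges_append_cons, ← List.reverse_cons, ih]
      simp [Sym2.eq_swap, add_comm, ← Multiset.singleton_add]

theorem pathEdges_map (f : V → W) (l : List V) :
    pathEdges (l.map f) = (pathEdges l).map (Sym2.map f) := by
  induction l with
  | nil => rfl
  | cons a l ih =>
    cases l with
    | nil => rfl
    | cons b l => simpa using ih

theorem pathEdges_concat_append {l : List V} {t : V} (h : l.getLast? = some t) (m : List V) :
    pathEdges (l ++ m) = pathEdges l + pathEdges (t :: m) := by
  obtain ⟨l, rfl⟩ := List.getLast?_eq_some_iff.1 h
  rw [List.append_assoc, List.singleton_append, pathEdges_append_cons]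

theorem mem_of_mem_pathEdges {l : List V} {e : Sym2 V} (he : e ∈ pathEdges l) {v : V}
    (hv : v ∈ e) : v ∈ l := by
  induction l with
  | nil => simp at he
  | cons a l ih =>
    cases l with
    | nil => simp at he
    | cons b l =>
      rw [pathEdges_cons_cons, Multiset.mem_cons] at he
      rcases he with rfl | he
      · rcases Sym2.mem_iff.1 hv with rfl | rfl <;> simp
      · exact List.mem_cons_of_mem _ (ih he)

theorem pathEnds_reverse (l : List V) : pathEnds l.reverse = pathEnds l := by
  induction l using List.reverseRecOn with
  | nil => rfl
  | append_singleton l a _ =>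
    cases l with
    | nil => rfl
    | cons b l =>
      simpa [pathEnds, List.getLastD_eq_getLast?] using Multiset.pair_comm a b

theorem mem_of_mem_pathEnds {l : List V} {v : V} (h : v ∈ pathEnds l) : v ∈ l := by
  cases l with
  | nil => simp [pathEnds] at h
  | cons a l =>
    simp only [pathEnds, Multiset.insert_eq_cons, Multiset.mem_cons, Multiset.mem_singleton] at h
    rcases h with rfl | rfl
    · simp
    · exact List.getLastD_mem_cons

/-- In a path, the number of incident edges and the number of ends at a vertex have the same
parity. -/
theorem even_countP_pathEdges_add_count_pathEnds [DecidableEq V] {l : List V}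
    (hl : l.Nodup) (v : V) :
    Even ((pathEdges l).countP (v ∈ ·) + (pathEnds l).count v) := by
  induction l with
  | nil => simp [pathEnds]
  | cons a l ih =>
    cases l with
    | nil =>
      by_cases h : v = a <;> simp [pathEnds, h]
    | cons b l =>
      have hab : a ≠ b := by rintro rfl; simp at hl
      have := ih hl.of_cons
      simp only [pathEnds, pathEdges_cons_cons, Multiset.countP_cons, Sym2.mem_iff,
        Multiset.insert_eq_cons, Multiset.count_cons, List.getLastD_cons] at this ⊢
      by_cases h1 : v = a <;> by_cases h2 : v = b <;>
        simp_all [Nat.even_add_one, Nat.even_add, parity_simps]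

/-- Starting from `b` and moving from `o j` to `i j` as long as possible, one reaches a vertex `c`
satisfying `Fr`. -/
theorem exists_chain [DecidableEq ι] (s : Finset ι) (o i : ι → V) (b : V) (Fr : V → Prop)
    (hinj : Set.InjOn i s) (hb : ∀ j ∈ s, i j ≠ b)
    (hcov : ∀ v, (v = b ∨ ∃ j ∈ s, v = i j) → Fr v ∨ ∃ j ∈ s, v = o j) :
    ∃ F ⊆ s, ∃ c, Fr c ∧ b ::ₘ F.val.map i = c ::ₘ F.val.map o := by
  induction s using Finset.strongInduction generalizing b with
  | H s ih =>
    rcases hcov b (Or.inl rfl) with h | ⟨j, hj, rfl⟩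
    · exact ⟨∅, by simp, b, h, by simp⟩
    · obtain ⟨F, hF, c, hc, h⟩ := ih (s.erase j) (Finset.erase_ssubset hj) (i j)
        (hinj.mono (by simp))
        (fun k hk h => (Finset.mem_erase.1 hk).1
          (hinj (Finset.mem_coe.2 (Finset.mem_erase.1 hk).2) (Finset.mem_coe.2 hj) h))
        (by
          rintro v hv
          have hv' : ∃ k ∈ s, v = i k := by
            rcases hv with rfl | ⟨k, hk, rfl⟩
            · exact ⟨j, hj, rfl⟩
            · exact ⟨k, (Finset.mem_erase.1 hk).2, rfl⟩
          have hne : v ≠ o j := by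
            obtain ⟨k, hk, rfl⟩ := hv'
            exact hb k hk
          rcases hcov v (Or.inr hv') with h | ⟨k, hk, rfl⟩
          · exact Or.inl h
          · exact Or.inr ⟨k, Finset.mem_erase.2 ⟨fun e => hne (by rw [e]), hk⟩, rfl⟩)
      have hjF : j ∉ F := fun h => (Finset.mem_erase.1 (hF h)).1 rfl
      refine ⟨insert j F, Finset.insert_subset hj (hF.trans (Finset.erase_subset _ _)), c, hc, ?_⟩
      rw [Finset.insert_val_of_notMem hjF, Multiset.map_cons, Multiset.map_cons, h,
        Multiset.cons_swap]

/-- If each value is taken by at most two ends `(i, β)`, then the ends can be two-coloured so that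
the two ends of each `i`, and the two ends sharing a value, get different colours. -/
theorem exists_orientation [DecidableEq ι] (s : Finset ι) (x : ι × Bool → V)
    (h : ∀ p q r : ι × Bool, p.1 ∈ s → q.1 ∈ s → r.1 ∈ s → x p = x q → x q = x r →
      p = q ∨ q = r ∨ p = r) :
    ∃ c : ι × Bool → Bool, (∀ i ∈ s, c (i, true) = !c (i, false)) ∧
      ∀ p q : ι × Bool, p.1 ∈ s → q.1 ∈ s → x p = x q → c p = c q → p = q := by
  induction s using Finset.strongInduction generalizing x with
  | H s ih =>
    rcases s.eq_empty_or_nonempty with rfl | ⟨j, hj⟩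
    · exact ⟨fun _ => true, by simp, by simp⟩
    have key : ∀ p : ι × Bool, p.1 ∈ s → p.1 ∈ s.erase j ∨ p = (j, false) ∨ p = (j, true) := by
      rintro ⟨i, β⟩ hi
      by_cases hij : i = j
      · subst hij; cases β <;> simp
      · exact Or.inl (Finset.mem_erase.2 ⟨hij, hi⟩)
    have hsub : ∀ i ∈ s.erase j, i ∈ s := fun i hi => Finset.mem_of_mem_erase hi
    by_cases hq : ∃ q : ι × Bool, q.1 ∈ s.erase j ∧ x q = x (j, true)
    · obtain ⟨q, hq, hxq⟩ := hq
      obtain ⟨c, hc, hc'⟩ := ih (s.erase j) (Finset.erase_ssubset hj)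
        (fun p => x (if p = q then (j, false) else p)) (by
          intro p q r hp hq hr h1 h2
          have := h _ _ _ (by grind) (by grind) (by grind) h1 h2
          grind)
      refine ⟨fun p => if p = (j, false) then c q else if p = (j, true) then !c q else c p, ?_, ?_⟩
      · intro i hi
        by_cases hij : i = j
        · simp [hij]
        · simpa [hij] using hc i (Finset.mem_erase.2 ⟨hij, hi⟩)
      · have h3 : ∀ p : ι × Bool, p.1 ∈ s → x p = x (j, true) → p = (j, true) ∨ p = q := by
          intro p hp e
          have := h p (j, true) q hp hj (hsub _ hq) e hxq.symm
          grind
        have h4 : ∀ p : ι × Bool, p.1 ∈ s.erase j → x p = x (j, false) → p ≠ q ∧ c p ≠ c q := by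
          intro p hp e
          have hpq : p ≠ q := by
            rintro rfl
            have := h3 (j, false) hj (by rw [← e, hxq])
            grind
          exact ⟨hpq, fun hcc => hpq (hc' p q hp hq (by simp [hpq, e]) hcc)⟩
        have h5 : ∀ p r : ι × Bool, p.1 ∈ s.erase j → r.1 ∈ s.erase j → x p = x r → c p = c r →
            p = r := by
          intro p r hp hr e hcc
          by_cases hpq : p = q
          · have := h3 r (hsub _ hr) (by rw [← e, hpq, hxq])
            grind
          by_cases hrq : r = q
          · have := h3 p (hsub _ hp) (by rw [e, hrq, hxq])
            grind
          exact hc' p r hp hr (by simpa [hpq, hrq] using e) hcc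
        intro p r hp hr e hcc
        have := key p hp
        have := key r hr
        grind
    · push Not at hq
      obtain ⟨c, hc, hc'⟩ := ih (s.erase j) (Finset.erase_ssubset hj) x (by grind)
      have hk : ∃ k : Bool, ∀ r : ι × Bool, r.1 ∈ s.erase j → x r = x (j, false) → c r = !k := by
        by_cases hr : ∃ r : ι × Bool, r.1 ∈ s.erase j ∧ x r = x (j, false)
        · obtain ⟨r, hr, hxr⟩ := hr
          refine ⟨!c r, fun r' hr' e => ?_⟩
          have := h r r' (j, false) (hsub _ hr) (hsub _ hr') hj (by rw [e, hxr]) e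
          grind
        · push Not at hr
          exact ⟨true, fun r h1 h2 => absurd h2 (hr r h1)⟩
      obtain ⟨k, hk⟩ := hk
      refine ⟨fun p => if p = (j, false) then k else if p = (j, true) then !k else c p, ?_, ?_⟩
      · intro i hi
        by_cases hij : i = j
        · simp [hij]
        · simpa [hij] using hc i (Finset.mem_erase.2 ⟨hij, hi⟩)
      · intro p r hp hr e hcc
        have := key p hp
        have := key r hr
        grind

theorem pathEdges_cons (a : V) (l : List V) :
    pathEdges (a :: l) = (if l = [] then 0 else {s(a, l.headD a)}) + pathEdges l := by
  cases l <;> simp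

theorem pathEdges_reverse_append_cons (l : List V) (a : V) (m : List V) :
    pathEdges (l.reverse ++ a :: m) = pathEdges (a :: l) + pathEdges (a :: m) := by
  rw [pathEdges_append_cons, ← List.reverse_cons, pathEdges_reverse]

theorem pathEnds_reverse_append_cons (l : List V) (a : V) (m : List V) :
    pathEnds (l.reverse ++ a :: m) = {l.getLastD a, m.getLastD a} := by
  induction l using List.reverseRecOn with
  | nil => rfl
  | append_singleton l c _ =>
    simp [pathEnds, List.getLastD_eq_getLast?, List.getLast?_cons]

theorem pathEdges_flip (a : V) {l : List V} (h : l ≠ []) :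
    pathEdges (a :: l.reverse) + {s(a, l.headD a)} =
      pathEdges (a :: l) + {s(a, l.getLastD a)} := by
  rw [pathEdges_cons, pathEdges_cons, pathEdges_reverse]
  have : l.reverse.headD a = l.getLastD a := by
    simp [List.headD_eq_head?_getD, List.getLastD_eq_getLast?]
  simp only [List.reverse_eq_nil_iff, h, if_false, this]
  abel

/-- A new edge `ab` can be added to a family of edge-disjoint paths, moving one path end from `b`
to `a`, as soon as `b` and all the neighbours of `a` are ends of paths of the family. -/
theorem exists_add_edge {κ : Type*} [Fintype κ] (P : κ → List V)
    (hP : ∀ k, (P k).Nodup) {a b : V} (hab : a ≠ b) (hnd : (∑ k, pathEdges (P k)).Nodup)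
    (hE : s(a, b) ∉ ∑ k, pathEdges (P k))
    (hcov : ∀ v, v = b ∨ s(a, v) ∈ ∑ k, pathEdges (P k) → v ∈ ∑ k, pathEnds (P k)) :
    ∃ P' : κ → List V, (∀ k, (P' k).Nodup) ∧
      ∑ k, pathEdges (P' k) = s(a, b) ::ₘ ∑ k, pathEdges (P k) ∧
      b ::ₘ ∑ k, pathEnds (P' k) = a ::ₘ ∑ k, pathEnds (P k) := by
  classical
  have hr : ∀ k, ∃ l : Bool → List V, a ∈ P k → P k = (l false).reverse ++ a :: l true := by
    intro k
    by_cases h : a ∈ P k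
    · obtain ⟨l, m, h⟩ := List.append_of_mem h
      exact ⟨fun β => bif β then m else l.reverse, fun _ => by simpa using h⟩
    · exact ⟨fun _ => [], fun h' => absurd h' h⟩
  choose r hr using hr
  have hnd' : ∀ k, a ∈ P k → (a :: r k false).Nodup ∧ (a :: r k true).Nodup ∧
      ∀ v ∈ r k false, v ∉ r k true := by
    intro k hk
    have := hP k
    rw [hr k hk] at this
    grind [List.nodup_append, List.nodup_cons, List.nodup_reverse]
  set s : Finset (κ × Bool) := Finset.univ.filter fun p => a ∈ P p.1 ∧ r p.1 p.2 ≠ [] with hs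
  set o : κ × Bool → V := fun p => (r p.1 p.2).getLastD a with ho
  set i : κ × Bool → V := fun p => (r p.1 p.2).headD a with hi
  have hmemi : ∀ p ∈ s, i p ∈ r p.1 p.2 := by
    intro p hp
    obtain ⟨c, l, hl⟩ := List.exists_cons_of_ne_nil (Finset.mem_filter.1 hp).2.2
    simp [hi, hl]
  have hedge : ∀ p ∈ s, s(a, i p) ∈ pathEdges (P p.1) := by
    intro p hp
    have hp' := (Finset.mem_filter.1 hp).2
    obtain ⟨c, l, hl⟩ := List.exists_cons_of_ne_nil hp'.2
    rw [hr _ hp'.1, pathEdges_reverse_append_cons]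
    obtain ⟨k, β⟩ := p
    dsimp only at hl
    cases β <;> simp [hi, hl]
  have hinj : Set.InjOn i s := by
    intro p hp q hq hpq
    have hp0 := hp
    have hq0 := hq
    have h1 := hedge p hp
    have h2 := hedge q hq
    rw [← hpq] at h2
    have hk : p.1 = q.1 := by
      by_contra hne
      rw [← Finset.add_sum_erase _ _ (Finset.mem_univ p.1),
        ← Finset.add_sum_erase _ _ (Finset.mem_erase.2 ⟨Ne.symm hne, Finset.mem_univ q.1⟩),
        ← add_assoc] at hnd
      exact Multiset.disjoint_left.1
        (Multiset.nodup_add.1 (Multiset.nodup_add.1 hnd).1).2.2 h1 h2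
    obtain ⟨k, β⟩ := p
    obtain ⟨k', β'⟩ := q
    obtain rfl : k = k' := hk
    have m1 := hmemi _ hp
    have m2 := hmemi _ hq
    rw [← hpq] at m2
    have := (hnd' k (Finset.mem_filter.1 hp).2.1).2.2
    cases β <;> cases β'
    · rfl
    · exact absurd m2 (this _ m1)
    · exact absurd m1 (this _ m2)
    · rfl
  have hle : ∀ k, ∀ e ∈ pathEdges (P k), e ∈ ∑ k, pathEdges (P k) := fun k e he =>
    Multiset.mem_sum.2 ⟨k, Finset.mem_univ k, he⟩
  obtain ⟨F, hF, c, ⟨k₀, hk₀, hc⟩, hFc⟩ := exists_chain s o i b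
    (fun v => ∃ k, a ∉ P k ∧ v ∈ pathEnds (P k)) hinj
    (fun p hp h => hE (h ▸ hle _ _ (hedge p hp))) (by
      intro v hv
      have hva : v ≠ a := by
        rcases hv with rfl | ⟨p, hp, rfl⟩
        · exact hab.symm
        · rintro h
          have h1 := hmemi p hp
          have h2 := hnd' _ (Finset.mem_filter.1 hp).2.1
          rw [h] at h1
          obtain ⟨k, β⟩ := p
          cases β
          · exact (List.nodup_cons.1 h2.1).1 h1
          · exact (List.nodup_cons.1 h2.2.1).1 h1
      have := hcov v (hv.imp_right fun ⟨p, hp, e⟩ => e ▸ hle _ _ (hedge p hp))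
      obtain ⟨k, -, hk⟩ := Multiset.mem_sum.1 this
      by_cases hak : a ∈ P k
      · right
        rw [hr k hak, pathEnds_reverse_append_cons] at hk
        have : ∃ β, v = o (k, β) := by
          simp only [Multiset.insert_eq_cons, Multiset.mem_cons, Multiset.mem_singleton] at hk
          exact hk.elim (fun h => ⟨false, h⟩) fun h => ⟨true, h⟩
        obtain ⟨β, rfl⟩ := this
        refine ⟨(k, β), Finset.mem_filter.2 ⟨Finset.mem_univ _, hak, fun h => hva ?_⟩, rfl⟩
        have h' : r k β = [] := h
        simp [ho, h']
      · exact Or.inl ⟨k, hak, hk⟩)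
  obtain ⟨Q, hQn, hQE, hQe⟩ : ∃ Q : List V, (a :: Q).Nodup ∧
      pathEdges (a :: Q) = pathEdges (P k₀) + {s(a, c)} ∧
      pathEnds (a :: Q) + {c} = pathEnds (P k₀) + {a} := by
    have main : ∀ l : List V, l.Nodup → a ∉ l → l.head? = some c → (a :: l).Nodup ∧
        pathEdges (a :: l) = pathEdges l + {s(a, c)} ∧
        pathEnds (a :: l) + {c} = pathEnds l + {a} := by
      rintro (_ | ⟨d, l⟩) hl hal h
      · simp at h
      · obtain rfl : d = c := by simpa using h
        refine ⟨List.nodup_cons.2 ⟨hal, hl⟩, ?_, ?_⟩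
        · simp [add_comm, ← Multiset.singleton_add]
        · simp only [pathEnds, List.getLastD_cons, Multiset.insert_eq_cons,
            ← Multiset.singleton_add]
          abel
    rcases hPk : P k₀ with _ | ⟨d, l⟩
    · simp [hPk, pathEnds] at hc
    · rw [hPk] at hc hk₀
      have hn := hP k₀
      rw [hPk] at hn
      simp only [pathEnds, Multiset.insert_eq_cons, Multiset.mem_cons,
        Multiset.mem_singleton] at hc
      rcases hc with rfl | hc
      · exact ⟨_, main _ hn hk₀ rfl⟩
      · refine ⟨(d :: l).reverse, ?_⟩
        rw [← pathEdges_reverse (d :: l), ← pathEnds_reverse (d :: l)]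
        refine main _ (List.nodup_reverse.2 hn) (by simpa [and_comm] using hk₀) ?_
        rw [hc, List.head?_reverse, List.getLast?_cons, List.getLastD_eq_getLast?]
  set f : κ × Bool → List V := fun p => if p ∈ F then (r p.1 p.2).reverse else r p.1 p.2 with hf
  have hfE : ∀ p, pathEdges (a :: f p) + (if p ∈ F then {s(a, i p)} else 0) =
      pathEdges (a :: r p.1 p.2) + (if p ∈ F then {s(a, o p)} else 0) := by
    intro p
    by_cases hp : p ∈ F
    · simp only [hf, hp, if_true]
      exact pathEdges_flip a (Finset.mem_filter.1 (hF hp)).2.2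
    · simp [hf, hp]
  have hfe : ∀ p, ({(f p).getLastD a} : Multiset V) + (if p ∈ F then {o p} else 0) =
      {(r p.1 p.2).getLastD a} + (if p ∈ F then {i p} else 0) := by
    intro p
    by_cases hp : p ∈ F
    · simp only [hf, hp, if_true, ho, hi]
      rw [add_comm]
      congr 2
      simp [List.headD_eq_head?_getD, List.getLastD_eq_getLast?]
    · simp [hf, hp]
  have hFk : ∀ k β, a ∉ P k → (k, β) ∉ F := fun k β h h' => h (Finset.mem_filter.1 (hF h')).2.1
  have hsum : ∀ {α : Type _} (g : κ × Bool → α),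
      ∑ k, ∑ β, (if (k, β) ∈ F then ({g (k, β)} : Multiset α) else 0) = F.val.map g := by
    intro α g
    rw [← Fintype.sum_prod_type (f := fun p => if p ∈ F then ({g p} : Multiset α) else 0),
      Finset.sum_ite_mem, Finset.univ_inter]
    rw [← Multiset.sum_map_singleton (F.val.map g), Multiset.map_map]
    rfl
  refine ⟨fun k => if k = k₀ then a :: Q else
    if a ∈ P k then (f (k, false)).reverse ++ a :: f (k, true) else P k, ?_, ?_, ?_⟩
  · intro k
    by_cases hk : k = k₀
    · simpa [hk] using hQn
    by_cases hak : a ∈ P k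
    · simp only [hk, hak, if_true, if_false]
      have := hnd' k hak
      have hm : ∀ β v, v ∈ f (k, β) ↔ v ∈ r k β := by
        intro β v
        by_cases h : (k, β) ∈ F <;> simp [hf, h]
      have hn : ∀ β, (f (k, β)).Nodup ↔ (r k β).Nodup := by
        intro β
        by_cases h : (k, β) ∈ F <;> simp [hf, h]
      grind [List.nodup_append, List.nodup_cons, List.nodup_reverse]
    · simpa [hk, hak] using hP k
  · have h1 : ∀ k, pathEdges (if k = k₀ then a :: Q else
        if a ∈ P k then (f (k, false)).reverse ++ a :: f (k, true) else P k) +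
        ∑ β, (if (k, β) ∈ F then {s(a, i (k, β))} else 0) =
        pathEdges (P k) + ∑ β, (if (k, β) ∈ F then {s(a, o (k, β))} else 0) +
        if k = k₀ then {s(a, c)} else 0 := by
      intro k
      by_cases hk : k = k₀
      · subst hk
        simp [hFk _ _ hk₀, hQE]
      by_cases hak : a ∈ P k
      · simp only [hk, hak, if_true, if_false]
        rw [pathEdges_reverse_append_cons, hr k hak, pathEdges_reverse_append_cons]
        have e1 := hfE (k, false)
        have e2 := hfE (k, true)
        rw [Fintype.sum_bool, Fintype.sum_bool, add_zero]
        calc _ = _ := by rw [add_comm (ite _ _ _), add_add_add_comm]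
          _ = _ := congrArg₂ (· + ·) e1 e2
          _ = _ := by rw [add_add_add_comm, add_comm (ite _ _ _)]
      · simp [hk, hak, hFk _ _ hak]
    have h2 := Finset.sum_congr (rfl : (Finset.univ : Finset κ) = _) fun k _ => h1 k
    simp only [Finset.sum_add_distrib] at h2
    rw [hsum fun p => s(a, i p), hsum fun p => s(a, o p), Finset.sum_ite_eq' Finset.univ k₀,
      if_pos (Finset.mem_univ _)] at h2
    have h3 := congrArg (Multiset.map fun v => s(a, v)) hFc
    simp only [Multiset.map_cons, Multiset.map_map, Function.comp_def] at h3
    refine add_right_cancel (h2.trans ?_)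
    rw [add_assoc, add_comm _ {s(a, c)}, Multiset.singleton_add, ← h3, Multiset.cons_add,
      Multiset.add_cons]
  · have h1 : ∀ k, pathEnds (if k = k₀ then a :: Q else
        if a ∈ P k then (f (k, false)).reverse ++ a :: f (k, true) else P k) +
        ∑ β, (if (k, β) ∈ F then {o (k, β)} else 0) + (if k = k₀ then {c} else 0) =
        pathEnds (P k) + ∑ β, (if (k, β) ∈ F then {i (k, β)} else 0) +
        if k = k₀ then {a} else 0 := by
      intro k
      by_cases hk : k = k₀
      · subst hk
        simp [hFk _ _ hk₀, hQe]
      by_cases hak : a ∈ P k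
      · simp only [hk, hak, if_true, if_false]
        rw [pathEnds_reverse_append_cons, hr k hak, pathEnds_reverse_append_cons]
        have e1 := hfe (k, false)
        have e2 := hfe (k, true)
        rw [Fintype.sum_bool, Fintype.sum_bool, add_zero, add_zero, Multiset.insert_eq_cons,
          Multiset.insert_eq_cons, ← Multiset.singleton_add, ← Multiset.singleton_add]
        calc _ = _ := by rw [add_comm (ite _ _ _), add_add_add_comm]
          _ = _ := congrArg₂ (· + ·) e1 e2
          _ = _ := by rw [add_add_add_comm, add_comm (ite _ _ _)]
      · simp [hk, hak, hFk _ _ hak]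
    have h2 := Finset.sum_congr (rfl : (Finset.univ : Finset κ) = _) fun k _ => h1 k
    simp only [Finset.sum_add_distrib] at h2
    rw [hsum i, hsum o, Finset.sum_ite_eq' Finset.univ k₀, Finset.sum_ite_eq' Finset.univ k₀,
      if_pos (Finset.mem_univ _), if_pos (Finset.mem_univ _)] at h2
    refine add_right_cancel (b := c ::ₘ F.val.map o) ?_
    simp only [← Multiset.singleton_add] at hFc ⊢
    rw [add_assoc]
    rw [add_comm ({c} : Multiset V) (F.val.map o), ← add_assoc (∑ _, _), h2,
      add_comm (F.val.map o) ({c} : Multiset V), ← hFc]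
    abel

theorem exists_mem_pathEdges_of_mem_pathEnds {l : List V} {v : V} (hv : v ∈ pathEnds l)
    (hl : l ≠ [v]) : ∃ w, s(v, w) ∈ pathEdges l := by
  have main : ∀ m : List V, m ≠ [v] → m.head? = some v → ∃ w, s(v, w) ∈ pathEdges m := by
    rintro (_ | ⟨a, _ | ⟨b, m⟩⟩) h1 h2
    · simp at h2
    · simp_all
    · obtain rfl : a = v := by simpa using h2
      exact ⟨b, by simp⟩
  rcases l with _ | ⟨a, l⟩
  · simp [pathEnds] at hv
  · simp only [pathEnds, Multiset.insert_eq_cons, Multiset.mem_cons, Multiset.mem_singleton] at hv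
    rcases hv with rfl | hv
    · exact main _ hl rfl
    · rw [← pathEdges_reverse]
      refine main _ (fun h => hl ?_) ?_
      · simpa using congrArg List.reverse h
      · rw [hv, List.head?_reverse, List.getLast?_cons, List.getLastD_eq_getLast?]

/-- A family of (possibly empty) paths whose edges make up `E`, with `c v` path ends at each
vertex `v`. -/
def IsPathFamily [DecidableEq V] {κ : Type*} [Fintype κ] (P : κ → List V) (E : Finset (Sym2 V))
    (c : V → ℕ) : Prop :=
  (∀ k, (P k).Nodup) ∧ ∑ k, pathEdges (P k) = E.val ∧ ∀ v, (∑ k, pathEnds (P k)).count v = c v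

theorem IsPathFamily.exists_insert [DecidableEq V] {κ : Type*} [Fintype κ] {P : κ → List V}
    {E : Finset (Sym2 V)} {c : V → ℕ} {a b : V} (hab : a ≠ b) (he : s(a, b) ∈ E)
    (h : IsPathFamily P (E.erase s(a, b)) c) (hc : ∀ v, v ≠ a → c v ≠ 0)
    (hdiag : ∀ e ∈ E, ¬ e.IsDiag) :
    ∃ (P' : κ → List V) (c' : V → ℕ), IsPathFamily P' E c' ∧
      ∀ v, c' v + (if v = b then 1 else 0) = c v + (if v = a then 1 else 0) := by
  obtain ⟨hn, hE, hends⟩ := h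
  obtain ⟨P', hn', hE', hends'⟩ := exists_add_edge P hn hab (by rw [hE]; exact Finset.nodup _)
    (by rw [hE]; exact Finset.notMem_erase _ _) (by
      intro v hv
      rw [← Multiset.count_ne_zero, hends]
      refine hc v ?_
      rintro rfl
      rcases hv with rfl | hv
      · exact hab rfl
      · rw [hE] at hv
        exact hdiag _ (Finset.mem_of_mem_erase hv) rfl)
  refine ⟨P', fun v => (∑ k, pathEnds (P' k)).count v, ⟨hn', ?_, fun v => rfl⟩, fun v => ?_⟩
  · rw [hE', hE, Finset.erase_val, Multiset.cons_erase he]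
  · have := congrArg (Multiset.count v) hends'
    rw [Multiset.count_cons, Multiset.count_cons, hends] at this
    exact this

/-- Lovász: every graph decomposes into paths such that odd vertices are the end of exactly one path
and even vertices are ends of exactly two; moreover one even vertex may be left with no end. -/
theorem exists_isPathFamily [Fintype V] [DecidableEq V] (E : Finset (Sym2 V))
    (hE : ∀ e ∈ E, ¬ e.IsDiag) :
    (∃ (n : ℕ) (P : Fin n → List V), IsPathFamily P E
      fun v => if Odd (E.val.countP (v ∈ ·)) then 1 else 2) ∧
    ∀ x, Even (E.val.countP (x ∈ ·)) → ∃ (n : ℕ) (P : Fin n → List V), IsPathFamily P E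
      fun v => if v = x then 0 else if Odd (E.val.countP (v ∈ ·)) then 1 else 2 := by
  induction E using Finset.strongInduction with
  | H E ih =>
    have hdeg : ∀ a b, s(a, b) ∈ E → a ≠ b → ∀ v, E.val.countP (v ∈ ·) =
        (E.erase s(a, b)).val.countP (v ∈ ·) + if v = a ∨ v = b then 1 else 0 := by
      intro a b h _ v
      conv_lhs => rw [← Finset.insert_erase h, Finset.insert_val_of_notMem (by simp)]
      simp [Multiset.countP_cons]
    have hIH : ∀ e ∈ E, _ := fun e he =>
      ih (E.erase e) (Finset.erase_ssubset he) fun e' h => hE e' (Finset.mem_of_mem_erase h)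
    have hne : ∀ a b, s(a, b) ∈ E → a ≠ b := fun a b h e => hE _ h e
    have h1 : ∃ (n : ℕ) (P : Fin n → List V), IsPathFamily P E
        fun v => if Odd (E.val.countP (v ∈ ·)) then 1 else 2 := by
      rcases E.eq_empty_or_nonempty with rfl | ⟨e, he⟩
      · refine ⟨Fintype.card V, fun i => [(Fintype.equivFin V).symm i], by simp, by simp, ?_⟩
        intro v
        rw [(Fintype.equivFin V).symm.sum_comp fun w => pathEnds [w]]
        simp [pathEnds, Multiset.count_sum', Multiset.count_cons, Multiset.count_singleton,
          Finset.sum_add_distrib]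
      · have key : ∀ a b, s(a, b) ∈ E → (Odd (E.val.countP (a ∈ ·)) → Odd (E.val.countP (b ∈ ·))) →
            ∃ (n : ℕ) (P : Fin n → List V), IsPathFamily P E
              fun v => if Odd (E.val.countP (v ∈ ·)) then 1 else 2 := by
          intro a b hab h
          have hd := hdeg a b hab (hne a b hab)
          have hab' := hne a b hab
          by_cases hodd : Odd (E.val.countP (a ∈ ·))
          · obtain ⟨n, P, hP⟩ := (hIH _ hab).2 a (by
              have := hd a
              simp only [true_or, if_true] at this
              rw [this] at hodd
              grind)
            obtain ⟨P', c', hP', hc'⟩ := hP.exists_insert hab' hab (by grind) hE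
            refine ⟨n, P', hP'.1, hP'.2.1, fun v => ?_⟩
            rw [hP'.2.2]
            have := hc' v
            have := hd v
            grind
          · obtain ⟨n, P, hP⟩ := (hIH _ hab).1
            obtain ⟨P', c', hP', hc'⟩ := hP.exists_insert hab' hab (by grind) hE
            by_cases hb : Odd (E.val.countP (b ∈ ·))
            · refine ⟨n, P', hP'.1, hP'.2.1, fun v => ?_⟩
              rw [hP'.2.2]
              have := hc' v
              have := hd v
              grind
            · refine ⟨n + 1, Fin.cons [b] P', Fin.cases (by simp) (by simpa using hP'.1), ?_,
                fun v => ?_⟩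
              · simpa [Fin.sum_univ_succ] using hP'.2.1
              · rw [Fin.sum_univ_succ]
                simp only [Fin.cons_zero, Fin.cons_succ, Multiset.count_add, hP'.2.2]
                have := hc' v
                have := hd v
                simp only [pathEnds, Multiset.insert_eq_cons, Multiset.count_cons,
                  Multiset.count_singleton, List.getLastD_nil]
                grind
        obtain ⟨a, b⟩ := e
        change s(a, b) ∈ E at he
        by_cases h : Odd (E.val.countP (a ∈ ·)) → Odd (E.val.countP (b ∈ ·))
        · exact key a b he h
        · exact key b a (Sym2.eq_swap ▸ he) (by tauto)
    refine ⟨h1, fun x hx => ?_⟩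
    by_cases hiso : ∃ z, s(z, x) ∈ E
    · obtain ⟨z, hz⟩ := hiso
      have hd := hdeg z x hz (hne z x hz)
      have hzx := hne z x hz
      by_cases hodd : Odd (E.val.countP (z ∈ ·))
      · obtain ⟨n, P, hP⟩ := (hIH _ hz).2 z (by have := hd z; grind)
        obtain ⟨P', c', hP', hc'⟩ := hP.exists_insert hzx hz (by grind) hE
        refine ⟨n, P', hP'.1, hP'.2.1, fun v => ?_⟩
        rw [hP'.2.2]
        have := hc' v
        have := hd v
        grind
      · obtain ⟨n, P, hP⟩ := (hIH _ hz).1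
        obtain ⟨P', c', hP', hc'⟩ := hP.exists_insert hzx hz (by grind) hE
        refine ⟨n, P', hP'.1, hP'.2.1, fun v => ?_⟩
        rw [hP'.2.2]
        have := hc' v
        have := hd v
        grind
    · obtain ⟨n, P, hP⟩ := h1
      have hnil : ∀ k, P k ≠ [x] → x ∉ pathEnds (P k) := by
        intro k hk hx
        obtain ⟨w, hw⟩ := exists_mem_pathEdges_of_mem_pathEnds hx hk
        refine hiso ⟨w, ?_⟩
        rw [Sym2.eq_swap, ← Finset.mem_val, ← hP.2.1]
        exact Multiset.mem_sum.2 ⟨k, Finset.mem_univ k, hw⟩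
      refine ⟨n, fun k => if P k = [x] then [] else P k, fun k => ?_, ?_, fun v => ?_⟩
      · by_cases h : P k = [x]
        · simp [h]
        · simpa [h] using hP.1 k
      · rw [← hP.2.1]
        refine Finset.sum_congr rfl fun k _ => ?_
        by_cases h : P k = [x] <;> simp [h]
      · dsimp only
        by_cases hv : v = x
        · subst hv
          rw [if_pos rfl, Multiset.count_eq_zero, Multiset.mem_sum]
          rintro ⟨k, -, hk⟩
          by_cases h : P k = [v]
          · simp [h, pathEnds] at hk
          · rw [if_neg h] at hk
            exact hnil k h hk
        · have hPv := hP.2.2 v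
          dsimp only at hPv
          rw [if_neg hv, ← hPv, Multiset.count_sum', Multiset.count_sum']
          refine Finset.sum_congr rfl fun k _ => ?_
          by_cases h : P k = [x] <;>
            simp [h, pathEnds, Multiset.count_cons, Multiset.count_singleton, hv]

theorem count_sum_pathEnds [DecidableEq V] {κ : Type*} [Fintype κ] [DecidableEq κ]
    (P : κ → List V) (v : V) :
    (∑ k, pathEnds (P k)).count v =
      (Finset.univ.filter fun p : κ × Bool =>
        (bif p.2 then (P p.1).getLast? else (P p.1).head?) = some v).card := by
  rw [Multiset.count_sum', Finset.card_filter, Fintype.sum_prod_type]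
  refine Finset.sum_congr rfl fun k _ => ?_
  rw [Fintype.sum_bool, cond_true, cond_false]
  rcases P k with _ | ⟨a, l⟩
  · simp [pathEnds]
  · simp only [pathEnds, Multiset.insert_eq_cons, Multiset.count_cons, Multiset.count_singleton,
      List.getLast?_cons, List.head?_cons,
      Option.some.injEq, List.getLastD_eq_getLast?, eq_comm (b := v)]

/-- Every graph decomposes into directed paths `R w` with distinct starts `w ∈ S` and distinct
ends `t w`, each vertex being a start or an end. -/
theorem exists_directed_paths [Fintype W] [DecidableEq W] (E : Finset (Sym2 W))
    (hE : ∀ e ∈ E, ¬ e.IsDiag) :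
    ∃ (S : Finset W) (R : W → List W) (t : W → W),
      (∀ w ∈ S, (R w).Nodup ∧ (R w).head? = some w ∧ (R w).getLast? = some (t w)) ∧
      Set.InjOn t S ∧ ∑ w ∈ S, pathEdges (R w) = E.val ∧ ∀ w, w ∈ S ∨ w ∈ S.image t := by
  obtain ⟨n, P, hn, hPE, hends⟩ := (exists_isPathFamily E hE).1
  let x : Fin n × Bool → Option W := fun p => bif p.2 then (P p.1).getLast? else (P p.1).head?
  let s : Finset (Fin n) := Finset.univ.filter fun k => P k ≠ []
  have hcard : ∀ v, (Finset.univ.filter fun p => x p = some v).card =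
      if Odd (E.val.countP (v ∈ ·)) then 1 else 2 := fun v => by
    have := hends v
    dsimp only at this
    rw [← this, count_sum_pathEnds]
  obtain ⟨c, hc, hc'⟩ := exists_orientation s x (by
    intro p q r hp _ _ hpq hqr
    obtain ⟨v, hv⟩ : ∃ v, x p = some v := by
      have : P p.1 ≠ [] := by simpa [s] using hp
      cases hb : p.2 <;> simp only [x, hb, cond_true, cond_false]
      · exact ⟨_, List.head?_eq_some_head this⟩
      · exact ⟨_, List.getLast?_eq_some_getLast this⟩
    by_contra! hne
    have : 2 < (Finset.univ.filter fun p => x p = some v).card :=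
      Finset.two_lt_card.2 ⟨p, by simpa, q, by simp [← hpq, hv], r, by simp [← hqr, ← hpq, hv],
        hne.1, hne.2.2, hne.2.1⟩
    rw [hcard] at this
    split_ifs at this <;> omega)
  let Q : Fin n → List W := fun k => bif c (k, false) then P k else (P k).reverse
  have hQ : ∀ k, P k ≠ [] → ∀ β, (if c (k, β) then (Q k).head? else (Q k).getLast?) = x (k, β) := by
    intro k hk β
    have := hc k (by simpa [s] using hk)
    cases h : c (k, false) <;> cases β <;> simp_all [Q, x]
  have hQnil : ∀ k, Q k = [] ↔ P k = [] := by
    intro k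
    cases h : c (k, false) <;> simp [Q, h]
  have hslot : ∀ k w, (Q k).head? = some w →
      ∃ p : Fin n × Bool, p.1 = k ∧ k ∈ s ∧ c p = true ∧ x p = some w := by
    intro k w hw
    have hk : P k ≠ [] := by
      rw [ne_eq, ← hQnil]; rintro h; simp [h] at hw
    have hks : k ∈ s := by simpa [s] using hk
    have := hc k hks
    cases h : c (k, false)
    · rw [h] at this
      refine ⟨(k, true), rfl, hks, by simpa using this, ?_⟩
      rw [← hQ k hk, if_pos (by simpa using this), hw]
    · refine ⟨(k, false), rfl, hks, h, ?_⟩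
      rw [← hQ k hk, if_pos h, hw]
  have hslot' : ∀ k w, (Q k).getLast? = some w →
      ∃ p : Fin n × Bool, p.1 = k ∧ k ∈ s ∧ c p = false ∧ x p = some w := by
    intro k w hw
    have hk : P k ≠ [] := by
      rw [ne_eq, ← hQnil]; rintro h; simp [h] at hw
    have hks : k ∈ s := by simpa [s] using hk
    have := hc k hks
    cases h : c (k, false)
    · refine ⟨(k, false), rfl, hks, h, ?_⟩
      rw [← hQ k hk, if_neg (by simp [h]), hw]
    · rw [h] at this
      refine ⟨(k, true), rfl, hks, by simpa using this, ?_⟩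
      rw [← hQ k hk, if_neg (by simp [this]), hw]
  have hhead : ∀ k k' w, (Q k).head? = some w → (Q k').head? = some w → k = k' := by
    intro k k' w h h'
    obtain ⟨p, rfl, hp, hcp, hxp⟩ := hslot k w h
    obtain ⟨q, rfl, hq, hcq, hxq⟩ := hslot k' w h'
    rw [hc' p q hp hq (by rw [hxp, hxq]) (by rw [hcp, hcq])]
  have hlast : ∀ k k' w, (Q k).getLast? = some w → (Q k').getLast? = some w → k = k' := by
    intro k k' w h h'
    obtain ⟨p, rfl, hp, hcp, hxp⟩ := hslot' k w h
    obtain ⟨q, rfl, hq, hcq, hxq⟩ := hslot' k' w h'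
    rw [hc' p q hp hq (by rw [hxp, hxq]) (by rw [hcp, hcq])]
  have hQ1 : ∀ w k, ∃ R : List W, ∃ t : W,
      (Q k).head? = some w → R = Q k ∧ R.getLast? = some t := by
    intro w k
    refine ⟨Q k, (Q k).getLastD w, fun h => ⟨rfl, ?_⟩⟩
    cases hq : Q k with
    | nil => simp [hq] at h
    | cons a l => rw [List.getLastD_eq_getLast?, List.getLast?_cons]; simp
  have hR : ∀ w, ∃ R : List W, ∃ t : W, ∀ k,
      (Q k).head? = some w → R = Q k ∧ R.getLast? = some t := by
    intro w
    by_cases h : ∃ k, (Q k).head? = some w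
    · obtain ⟨k, hk⟩ := h
      obtain ⟨R, t, h⟩ := hQ1 w k
      exact ⟨R, t, fun k' hk' => by rw [← hhead _ _ _ hk hk']; exact h hk⟩
    · exact ⟨[], w, fun k hk => (h ⟨k, hk⟩).elim⟩
  choose R t hR using hR
  have hS : ∀ w, w ∈ Finset.univ.filter (fun w => ∃ k, (Q k).head? = some w) ↔
      ∃ k, (Q k).head? = some w := by simp
  have hQE : ∀ k, pathEdges (Q k) = pathEdges (P k) := fun k => by
    cases h : c (k, false) <;> simp [Q, h, pathEdges_reverse]
  refine ⟨Finset.univ.filter fun w => ∃ k, (Q k).head? = some w, R, t, ?_, ?_, ?_, ?_⟩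
  · intro w hw
    obtain ⟨k, hk⟩ := (hS w).1 hw
    refine ⟨?_, by rw [(hR w k hk).1, hk], (hR w k hk).2⟩
    rw [(hR w k hk).1]
    cases h : c (k, false) <;> simpa [Q, h] using hn k
  · intro w hw w' hw' h
    obtain ⟨k, hk⟩ := (hS w).1 hw
    obtain ⟨k', hk'⟩ := (hS w').1 hw'
    have h1 := (hR w k hk).2
    have h2 := (hR w' k' hk').2
    rw [(hR w k hk).1] at h1
    rw [(hR w' k' hk').1] at h2
    rw [hlast k k' (t w) h1 (h ▸ h2), hk'] at hk
    exact (Option.some.inj hk).symm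
  · rw [← hPE]
    have h1 : ∀ k, pathEdges (P k) = ∑ w, if (Q k).head? = some w then pathEdges (R w) else 0 := by
      intro k
      cases hq : Q k with
      | nil => simp [(hQnil k).1 hq]
      | cons a l =>
        have ha : (Q k).head? = some a := by simp [hq]
        simp [(hR a k ha).1, hQE]
    rw [Finset.sum_congr rfl fun k _ => h1 k, Finset.sum_comm, Finset.sum_filter]
    refine Finset.sum_congr rfl fun w _ => ?_
    split_ifs with h
    · obtain ⟨k, hk⟩ := h
      rw [Finset.sum_eq_single k, if_pos hk]
      · intro k' _ hne
        rw [if_neg]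
        exact fun h => hne (hhead _ _ _ h hk)
      · simp
    · refine (Finset.sum_eq_zero fun k _ => if_neg fun hk => h ⟨k, hk⟩).symm
  · intro w
    obtain ⟨⟨k, β⟩, hp⟩ : (Finset.univ.filter fun p => x p = some w).Nonempty := by
      rw [← Finset.card_pos, hcard]
      split_ifs <;> omega
    have hp : x (k, β) = some w := by simpa using hp
    have hk : P k ≠ [] := by
      intro h
      cases β <;> simp [x, h] at hp
    have h1 := hQ k hk β
    rw [hp] at h1
    cases hcb : c (k, β)
    · right
      rw [hcb, if_neg (by simp)] at h1
      rw [Finset.mem_image]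
      obtain ⟨a, ha⟩ : ∃ a, (Q k).head? = some a :=
        ⟨_, List.head?_eq_some_head (mt (hQnil k).1 hk)⟩
      refine ⟨a, (hS a).2 ⟨k, ha⟩, ?_⟩
      have := (hR a k ha).2
      rw [(hR a k ha).1, h1] at this
      exact (Option.some.inj this).symm
    · left
      rw [hcb, if_pos rfl] at h1
      exact (hS w).2 ⟨k, h1⟩

/-- Prepending a copy of `H` over `u` to paths starting over `u`: those starting at `(u, t w)` are
precomposed with the copy of `R w`, the others start at `u` and are kept. -/
theorem sum_pathEdges_reroute [Fintype W] [DecidableEq W] {S : Finset W} {R : W → List W}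
    {t : W → W} (hR : ∀ w ∈ S, (R w).getLast? = some (t w)) (ht : Set.InjOn t S) (u : V)
    (A : W → List (V × W)) :
    ∑ w, pathEdges (if w ∈ S then (R w).map (u, ·) ++ A (t w) else [(u, w)]) +
        ∑ w ∈ (S.image t)ᶜ, pathEdges ((u, w) :: A w) =
      ∑ w, pathEdges ((u, w) :: A w) + ∑ w ∈ S, pathEdges ((R w).map (u, ·)) := by
  have h1 : ∀ w, pathEdges (if w ∈ S then (R w).map (u, ·) ++ A (t w) else [(u, w)]) =
      if w ∈ S then pathEdges ((R w).map (u, ·)) + pathEdges ((u, t w) :: A (t w)) else 0 := by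
    intro w
    split_ifs with h
    · exact pathEdges_concat_append (by simp [hR w h]) _
    · rfl
  rw [Finset.sum_congr rfl fun w _ => h1 w, ← Finset.sum_filter, Finset.filter_mem_eq_inter,
    Finset.univ_inter, Finset.sum_add_distrib,
    ← Finset.sum_image (f := fun w => pathEdges ((u, w) :: A w)) ht, add_assoc,
    Finset.sum_add_sum_compl, add_comm]

/-- Path decomposition of the product of the path `Q` with `W`, together with copies of `H` over the
vertices of `U`, into paths `A w` starting over the head of `Q` and further paths `C`. -/
theorem exists_columns [Fintype W] [DecidableEq V] [DecidableEq W] {S : Finset W}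
    {R : W → List W} {t : W → W}
    (hR : ∀ w ∈ S, (R w).Nodup ∧ (R w).head? = some w ∧ (R w).getLast? = some (t w))
    (ht : Set.InjOn t S) (U : Finset V) (Q : List V) (hQ : Q.Nodup)
    (hU : ∃ z ∈ U, Q.getLast? = some z) :
    ∃ (A : W → List (V × W)) (C : Multiset (List (V × W))),
      (∀ w, (A w).Nodup ∧ (A w).head? = Q.head?.map (·, w) ∧ ∀ x ∈ A w, x.1 ∈ Q) ∧
      (∀ l ∈ C, l.Nodup) ∧ (∀ u ∈ U, Q.head? = some u → ∀ w ∉ S, pathEdges (A w) = 0) ∧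
      ∑ w, pathEdges (A w) + (C.map pathEdges).sum = ∑ w, pathEdges (Q.map (·, w)) +
        ((Q.filter (· ∈ U)).map fun z => ∑ w ∈ S, pathEdges ((R w).map (z, ·))).sum ∧
      C.card + (S.image t)ᶜ.card = (Q.filter (· ∈ U)).length * (S.image t)ᶜ.card := by
  have hmark : ∀ (u : V) (A : W → List (V × W)), (∀ w, (A w).Nodup ∧ ∀ x ∈ A w, x.1 ≠ u) →
      ∀ w, (if w ∈ S then (R w).map (u, ·) ++ A (t w) else [(u, w)]).Nodup ∧
        (if w ∈ S then (R w).map (u, ·) ++ A (t w) else [(u, w)]).head? = some (u, w) := by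
    intro u A hA w
    split_ifs with h
    · refine ⟨List.nodup_append.2 ⟨(hR w h).1.map (by simp [Function.Injective]), (hA _).1, ?_⟩, ?_⟩
      · rintro x hx y hy rfl
        obtain ⟨z, -, rfl⟩ := List.mem_map.1 hx
        exact (hA _).2 _ hy rfl
      · rw [List.head?_append, List.head?_map, (hR w h).2.1]
        rfl
    · simp
  induction Q with
  | nil => simp at hU
  | cons u Q ih =>
    obtain ⟨huQ, hQ⟩ := List.nodup_cons.1 hQ
    rcases Q with _ | ⟨u', Q⟩
    · have huU : u ∈ U := by obtain ⟨z, hz, h⟩ := hU; simp at h; exact h ▸ hz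
      refine ⟨fun w => if w ∈ S then (R w).map (u, ·) ++ [] else [(u, w)], 0, fun w => ?_, by simp,
        ?_, ?_, by simp [huU]⟩
      · have := hmark u (fun _ => []) (by simp) w
        refine ⟨this.1, by simpa using this.2, fun x hx => ?_⟩
        dsimp only at hx
        split_ifs at hx
        · simp at hx; grind
        · simp_all
      · intro _ _ _ w hw; simp [hw]
      · have := sum_pathEdges_reroute (fun w h => (hR w h).2.2) ht u fun _ => []
        simpa [huU] using this
    · obtain ⟨A, C, hA, hC, -, hE, hcard⟩ := ih hQ (by simpa using hU)
      have hAu : ∀ w, (A w).Nodup ∧ ∀ x ∈ A w, x.1 ≠ u := fun w =>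
        ⟨(hA w).1, fun x hx h => huQ (h ▸ (hA w).2.2 x hx)⟩
      have hB : ∀ w, ((u, w) :: A w).Nodup := fun w =>
        List.nodup_cons.2 ⟨fun h => (hAu w).2 _ h rfl, (hA w).1⟩
      have hBE : ∀ w, pathEdges ((u, w) :: A w) = s((u, w), (u', w)) ::ₘ pathEdges (A w) := by
        intro w
        obtain ⟨l, hl⟩ : ∃ l, A w = (u', w) :: l := by
          have := (hA w).2.1
          cases h : A w <;> simp_all
        rw [hl, pathEdges_cons_cons]
      have hsum : ∑ w, pathEdges ((u, w) :: A w) + (C.map pathEdges).sum =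
          ∑ w, pathEdges ((u :: u' :: Q).map (·, w)) +
          (((u' :: Q).filter (· ∈ U)).map fun z => ∑ w ∈ S, pathEdges ((R w).map (z, ·))).sum := by
        simp only [hBE, List.map_cons, pathEdges_cons_cons, ← Multiset.singleton_add,
          Finset.sum_add_distrib] at hE ⊢
        rw [add_assoc, hE, add_assoc]
      by_cases huU : u ∈ U
      · refine ⟨fun w => if w ∈ S then (R w).map (u, ·) ++ A (t w) else [(u, w)],
          C + (S.image t)ᶜ.val.map fun w => (u, w) :: A w, fun w => ?_, ?_, ?_, ?_, ?_⟩
        · have := hmark u A hAu w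
          refine ⟨this.1, by simpa using this.2, fun x hx => ?_⟩
          have := (hA (t w)).2.2 x
          dsimp only at hx
          split_ifs at hx <;> grind
        · intro l hl
          rcases Multiset.mem_add.1 hl with h | h
          · exact hC l h
          · obtain ⟨w, -, rfl⟩ := Multiset.mem_map.1 h
            exact hB w
        · intro _ _ _ w hw; simp [hw]
        · have := sum_pathEdges_reroute (fun w h => (hR w h).2.2) ht u A
          rw [List.filter_cons_of_pos (by simpa), List.map_cons, List.sum_cons, Multiset.map_add,
            Multiset.sum_add, Multiset.map_map, add_comm (C.map pathEdges).sum, ← add_assoc]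
          change _ + ∑ w ∈ (S.image t)ᶜ, pathEdges ((u, w) :: A w) + _ = _
          rw [this, add_right_comm, hsum, add_assoc, add_comm (List.sum _)]
        · rw [List.filter_cons_of_pos (by simpa), List.length_cons, Multiset.card_add,
            Multiset.card_map, Finset.card_val, add_right_comm, hcard, add_one_mul]
      · refine ⟨fun w => (u, w) :: A w, C, fun w => ⟨hB w, by simp, fun x hx => ?_⟩, hC, ?_, ?_, ?_⟩
        · have := (hA w).2.2 x
          grind
        · grind
        · rw [hsum, List.filter_cons_of_neg (a := u) (by simpa)]
        · rw [hcard, List.filter_cons_of_neg (a := u) (by simpa)]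

/-- The product of the path `Q` with `W`, together with copies of `H` over the vertices of `U`,
decomposes into at most `|U ∩ Q| * |W| / 2` paths if `U` contains the ends of `Q`. -/
theorem exists_paths_over_path [Fintype W] [DecidableEq V] [DecidableEq W] {S : Finset W}
    {R : W → List W} {t : W → W}
    (hR : ∀ w ∈ S, (R w).Nodup ∧ (R w).head? = some w ∧ (R w).getLast? = some (t w))
    (ht : Set.InjOn t S) (hS : ∀ w, w ∈ S ∨ w ∈ S.image t) (U : Finset V) {Q : List V}
    (hQ : Q.Nodup) {a b : V} (ha : Q.head? = some a) (hb : Q.getLast? = some b) (hab : a ≠ b)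
    (haU : a ∈ U) (hbU : b ∈ U) :
    ∃ C : Multiset (List (V × W)), (∀ l ∈ C, l.Nodup) ∧
      (C.map pathEdges).sum = ∑ w, pathEdges (Q.map (·, w)) +
        ((Q.filter (· ∈ U)).map fun z => ∑ w ∈ S, pathEdges ((R w).map (z, ·))).sum ∧
      2 * C.card ≤ (Q.filter (· ∈ U)).length * Fintype.card W := by
  obtain ⟨A, C, hA, hC, hA0, hE, hcard⟩ := exists_columns hR ht U Q hQ ⟨b, hbU, hb⟩
  refine ⟨S.val.map A + C, ?_, ?_, ?_⟩
  · intro l hl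
    rcases Multiset.mem_add.1 hl with h | h
    · obtain ⟨w, -, rfl⟩ := Multiset.mem_map.1 h
      exact (hA w).1
    · exact hC l h
  · rw [← hE, Multiset.map_add, Multiset.sum_add, Multiset.map_map]
    congr 1
    exact Finset.sum_subset (Finset.subset_univ S) fun w _ hw => hA0 a haU ha w hw
  · have h2 : 2 ≤ (Q.filter (· ∈ U)).length := by
      have : ({a, b} : Finset V) ⊆ (Q.filter (· ∈ U)).toFinset := by
        have := List.mem_of_mem_head? ha
        have := List.mem_of_mem_getLast? hb
        intro x
        simp
        grind
      calc 2 = ({a, b} : Finset V).card := (Finset.card_pair hab).symm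
        _ ≤ _ := Finset.card_le_card this
        _ ≤ _ := List.toFinset_card_le _
    have h3 : (S.image t).card = S.card := Finset.card_image_of_injOn ht
    have h4 := Finset.card_add_card_compl (S.image t)
    have h5 : Fintype.card W ≤ S.card + S.card := by
      rw [← Finset.card_univ]
      nth_rewrite 2 [← h3]
      exact (Finset.card_le_card fun w _ => Finset.mem_union.2 (hS w)).trans
        (Finset.card_union_le _ _)
    rw [Multiset.card_add, Multiset.card_map, Finset.card_val]
    obtain ⟨k, hk⟩ := Nat.exists_eq_add_of_le h2
    rw [hk] at hcard ⊢
    nlinarith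

theorem pathEdges_support {G : SimpleGraph V} {u v : V} (p : G.Walk u v) :
    pathEdges p.support = (p.edges : Multiset (Sym2 V)) := by
  induction p with
  | nil => rfl
  | cons h p ih =>
    rw [Walk.support_cons, Walk.edges_cons, ← Multiset.cons_coe, ← ih, ← Walk.cons_tail_support p]
    rfl

theorem exists_walk_support_eq {G : SimpleGraph V} {l : List V} (hl : l ≠ [])
    (h : ∀ e ∈ pathEdges l, e ∈ G.edgeSet) :
    ∃ p : Σ u v : V, G.Walk u v, p.2.2.support = l := by
  induction l with
  | nil => exact (hl rfl).elim
  | cons a l ih =>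
    rcases l with _ | ⟨b, l⟩
    · exact ⟨⟨a, a, .nil⟩, rfl⟩
    · obtain ⟨⟨u, v, p⟩, hp⟩ := ih (by simp) fun e he => h e (by simp [he])
      obtain rfl : u = b := by
        rw [← Walk.cons_tail_support] at hp
        exact (List.cons.inj hp).1
      have hadj : G.Adj a u := h s(a, u) (by simp)
      exact ⟨⟨a, v, .cons hadj p⟩, congrArg (a :: ·) hp⟩

theorem sum_pathEdges_support {G : SimpleGraph V} (P : List (Σ u v : V, G.Walk u v)) :
    (P.map fun p => pathEdges p.2.2.support).sum =
      (P.flatMap fun p => p.2.2.edges : Multiset (Sym2 V)) := by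
  induction P with
  | nil => rfl
  | cons p P ih =>
    rw [List.map_cons, List.sum_cons, ih, pathEdges_support, List.flatMap_cons, Multiset.coe_add]

theorem exists_isPathDecomp_of_paths {G : SimpleGraph V} (P : Multiset (List V))
    (hP : ∀ l ∈ P, l.Nodup) (hnd : (P.map pathEdges).sum.Nodup)
    (hE : ∀ e, e ∈ (P.map pathEdges).sum ↔ e ∈ G.edgeSet) :
    ∃ L, G.IsPathDecomp L ∧ L.length ≤ P.card := by
  classical
  obtain ⟨M, hM⟩ := Quot.exists_rep (P.filter (· ≠ []))
  change (M : Multiset (List V)) = _ at hM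
  have hsum : (M.map pathEdges).sum = (P.map pathEdges).sum := by
    rw [← Multiset.filter_add_not (· ≠ []) P, Multiset.map_add, Multiset.sum_add, ← hM,
      Multiset.map_coe, Multiset.sum_coe, left_eq_add]
    refine Multiset.sum_eq_zero fun s hs => ?_
    obtain ⟨l, hl, rfl⟩ := Multiset.mem_map.1 hs
    obtain rfl : l = [] := by simpa using (Multiset.mem_filter.1 hl).2
    rfl
  have hMP : ∀ l ∈ M, l ∈ P ∧ l ≠ [] := fun l hl => by
    rwa [← Multiset.mem_coe, hM, Multiset.mem_filter] at hl
  obtain ⟨L, hL⟩ : M ∈ Set.range (List.map fun p : Σ u v : V, G.Walk u v => p.2.2.support) := by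
    rw [Set.range_list_map]
    refine fun l hl => exists_walk_support_eq (hMP l hl).2 fun e he => (hE e).1 ?_
    exact Multiset.mem_of_le
      (Multiset.single_le_sum (by simp) _ (Multiset.mem_map_of_mem _ (hMP l hl).1)) he
  subst hL
  rw [List.map_map] at hsum
  replace hsum := (sum_pathEdges_support L).symm.trans hsum
  rw [← hsum, Multiset.coe_nodup, List.nodup_flatMap] at hnd
  refine ⟨L, ⟨fun p hp => ?_, hnd.2, fun e he => ?_⟩, ?_⟩
  · exact Walk.IsPath.mk' (hP _ (hMP _ (List.mem_map_of_mem hp)).1)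
  · rw [← hE, ← hsum] at he
    simpa using he
  · rw [← List.length_map (f := fun p : Σ u v : V, G.Walk u v => p.2.2.support),
      ← Multiset.coe_card, hM]
    exact Multiset.card_le_card (Multiset.filter_le _ _)

theorem pathNumber_le_of_paths {G : SimpleGraph V} (P : Multiset (List V))
    (hP : ∀ l ∈ P, l.Nodup) (hnd : (P.map pathEdges).sum.Nodup)
    (hE : ∀ e, e ∈ (P.map pathEdges).sum ↔ e ∈ G.edgeSet) : G.pathNumber ≤ P.card := by
  obtain ⟨L, hL, hcard⟩ := exists_isPathDecomp_of_paths P hP hnd hE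
  refine le_trans (Nat.sInf_le ?_) hcard
  exact ⟨L, hL, rfl⟩

theorem exists_paths_of_pathNumber [Fintype V] (G : SimpleGraph V) [DecidableRel G.Adj] :
    ∃ Q : Fin G.pathNumber → List V, (∀ i, (Q i).Nodup) ∧
      ∑ i, pathEdges (Q i) = G.edgeFinset.val := by
  classical
  obtain ⟨n, P, hn, hPE, -⟩ := (exists_isPathFamily G.edgeFinset fun e he =>
    G.not_isDiag_of_mem_edgeSet (mem_edgeFinset.1 he)).1
  have hsum : ((Finset.univ.val.map P).map pathEdges).sum = G.edgeFinset.val := by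
    rw [Multiset.map_map, ← hPE]
    rfl
  obtain ⟨L₀, hL₀, -⟩ := exists_isPathDecomp_of_paths (G := G) (Finset.univ.val.map P)
    (by simpa using hn) (by rw [hsum]; exact Finset.nodup _)
    (fun e => by rw [hsum]; exact mem_edgeFinset)
  obtain ⟨L, ⟨hp, hd, hc⟩, hlen⟩ :=
    Nat.sInf_mem (s := {k | ∃ P, G.IsPathDecomp P ∧ P.length = k}) ⟨L₀.length, L₀, hL₀, rfl⟩
  change _ = G.pathNumber at hlen
  rw [← hlen]
  refine ⟨fun i => (L.get i).2.2.support, fun i => (hp _ (L.get_mem i)).support_nodup, ?_⟩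
  have : ∑ i, pathEdges (L.get i).2.2.support =
      (L.map fun p => pathEdges p.2.2.support).sum := by
    rw [← Fin.sum_univ_fun_getElem]
    rfl
  rw [this, sum_pathEdges_support]
  refine (Multiset.Nodup.ext ?_ (Finset.nodup _)).2 fun e => ?_
  · exact Multiset.coe_nodup.2 (List.nodup_flatMap.2 ⟨fun p h => (hp p h).isTrail.edges_nodup, hd⟩)
  · rw [Multiset.mem_coe, List.mem_flatMap, Finset.mem_val, mem_edgeFinset]
    exact ⟨fun ⟨p, _, he⟩ => p.2.2.edges_subset_edgeSet he, hc e⟩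

theorem nodup_sum_map_val {α β γ : Type*} [Fintype α] (s : Finset β) (f : α → β → γ)
    (hf : ∀ a, ∀ b ∈ s, ∀ a', ∀ b' ∈ s, f a b = f a' b' → a = a' ∧ b = b') :
    (∑ a, s.val.map (f a)).Nodup := by
  have : ∑ a, s.val.map (f a) = (Finset.univ ×ˢ s).val.map fun p => f p.1 p.2 := by
    change Multiset.bind _ _ = Multiset.map _ (Multiset.bind _ _)
    simp only [Multiset.map_bind, Multiset.map_map, Function.comp_def]
  rw [this]
  refine Multiset.Nodup.map_on ?_ (Finset.nodup _)
  rintro ⟨a, b⟩ h ⟨a', b'⟩ h' heq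
  obtain ⟨rfl, rfl⟩ := hf a b (by simpa using h) a' b' (by simpa using h') heq
  rfl

theorem nodup_boxProd_edges [Fintype V] [Fintype W] (G : SimpleGraph V) (H : SimpleGraph W)
    [Fintype G.edgeSet] [Fintype H.edgeSet] :
    (∑ w, G.edgeFinset.val.map (Sym2.map (·, w)) +
      ∑ u : V, H.edgeFinset.val.map (Sym2.map (u, ·))).Nodup := by
  refine Multiset.nodup_add.2 ⟨nodup_sum_map_val _ _ ?_, nodup_sum_map_val _ _ ?_, ?_⟩
  · rintro w ⟨a, b⟩ - w' ⟨a', b'⟩ - h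
    change s((a, w), (b, w)) = s((a', w'), (b', w')) at h
    change w = w' ∧ s(a, b) = s(a', b')
    grind
  · rintro w ⟨a, b⟩ - w' ⟨a', b'⟩ - h
    change s((w, a), (w, b)) = s((w', a'), (w', b')) at h
    change w = w' ∧ s(a, b) = s(a', b')
    grind
  · rw [Multiset.disjoint_left]
    intro e he he'
    simp only [Multiset.mem_sum, Multiset.mem_map, Finset.mem_univ, true_and] at he he'
    obtain ⟨w, ⟨a, b⟩, hab, rfl⟩ := he
    obtain ⟨u, ⟨c, d⟩, -, h⟩ := he'
    change s((u, c), (u, d)) = s((a, w), (b, w)) at h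
    have : G.Adj a b := mem_edgeFinset.1 hab
    have := this.ne
    grind

theorem mem_boxProd_edges [Fintype V] [Fintype W] (G : SimpleGraph V) (H : SimpleGraph W)
    [Fintype G.edgeSet] [Fintype H.edgeSet] (e : Sym2 (V × W)) :
    e ∈ ∑ w, G.edgeFinset.val.map (Sym2.map (·, w)) +
      ∑ u : V, H.edgeFinset.val.map (Sym2.map (u, ·)) ↔ e ∈ (G □ H).edgeSet := by
  simp only [Multiset.mem_add, Multiset.mem_sum, Multiset.mem_map, Finset.mem_univ, true_and,
    Finset.mem_val, mem_edgeFinset]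
  induction e using Sym2.ind with
  | _ x y =>
    rw [mem_edgeSet, boxProd_adj]
    constructor
    · rintro (⟨w, ⟨a, b⟩, hab, h⟩ | ⟨u, ⟨a, b⟩, hab, h⟩)
      · change G.Adj a b at hab
        change s((a, w), (b, w)) = s(x, y) at h
        have := hab.symm
        grind
      · change H.Adj a b at hab
        change s((u, a), (u, b)) = s(x, y) at h
        have := hab.symm
        grind
    · obtain ⟨a, c⟩ := x
      obtain ⟨b, d⟩ := y
      rintro (⟨h, rfl⟩ | ⟨h, rfl⟩)
      · exact .inl ⟨_, s(a, b), h, rfl⟩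
      · exact .inr ⟨_, s(c, d), h, rfl⟩

theorem degree_eq_countP [Fintype V] [DecidableEq V] (G : SimpleGraph V) [DecidableRel G.Adj]
    (v : V) : G.degree v = G.edgeFinset.val.countP (v ∈ ·) := by
  rw [← card_incidenceFinset_eq_degree, incidenceFinset_eq_filter, Multiset.countP_eq_card_filter]
  rfl

theorem card_pathEnds_le (l : List V) : (pathEnds l).card ≤ 2 := by
  rcases l with _ | ⟨a, l⟩ <;> simp [pathEnds]

/-- If `p(G) = n_o(G)/2` then in a minimum path decomposition each odd vertex is an end exactly
once, and no even vertex is an end. -/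
theorem sum_pathEnds_eq [Fintype V] [DecidableEq V] (G : SimpleGraph V) [DecidableRel G.Adj]
    {κ : Type*} [Fintype κ] (hp : 2 * Fintype.card κ = G.oddCount) {Q : κ → List V}
    (hQ : ∀ i, (Q i).Nodup) (hE : ∑ i, pathEdges (Q i) = G.edgeFinset.val) :
    ∑ i, pathEnds (Q i) = (Finset.univ.filter fun v => Odd (G.degree v)).val := by
  symm
  apply Multiset.eq_of_le_of_card_le
  · rw [Multiset.le_iff_subset (Finset.nodup _)]
    intro v hv
    have hodd : Odd (G.degree v) := by simpa using hv
    rw [← Multiset.count_ne_zero]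
    intro h0
    have : Even (∑ i, ((pathEdges (Q i)).countP (v ∈ ·) + (pathEnds (Q i)).count v)) :=
      Finset.even_sum _ fun i _ => even_countP_pathEdges_add_count_pathEnds (hQ i) v
    rw [Finset.sum_add_distrib, ← Multiset.count_sum', h0, add_zero] at this
    rw [degree_eq_countP, ← hE] at hodd
    have h : (∑ i, pathEdges (Q i)).countP (v ∈ ·) = ∑ i, (pathEdges (Q i)).countP (v ∈ ·) :=
      map_sum (Multiset.countPAddMonoidHom (v ∈ ·)) _ _
    rw [h] at hodd
    exact Nat.not_even_iff_odd.2 hodd this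
  · rw [Multiset.card_sum]
    calc _ ≤ ∑ _ : κ, 2 := Finset.sum_le_sum fun i _ => card_pathEnds_le _
      _ = G.oddCount := by rw [← hp]; simp [mul_comm]

theorem exists_ends [Fintype V] [DecidableEq V] (G : SimpleGraph V) [DecidableRel G.Adj]
    {κ : Type*} [Fintype κ] (hp : 2 * Fintype.card κ = G.oddCount) {Q : κ → List V}
    (hQ : ∀ i, (Q i).Nodup) (hE : ∑ i, pathEdges (Q i) = G.edgeFinset.val) (i : κ) :
    ∃ a b, a ≠ b ∧ (Q i).head? = some a ∧ (Q i).getLast? = some b ∧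
      a ∈ pathEnds (Q i) ∧ b ∈ pathEnds (Q i) := by
  have hends := sum_pathEnds_eq G hp hQ hE
  have hcard : ∑ i, (pathEnds (Q i)).card = ∑ _ : κ, 2 := by
    rw [← Multiset.card_sum, hends, Finset.card_val]
    change G.oddCount = _
    rw [← hp]
    simp [mul_comm]
  have hi := (Finset.sum_eq_sum_iff_of_le fun i _ => card_pathEnds_le (Q i)).1 hcard i
    (Finset.mem_univ i)
  have hnd : (pathEnds (Q i)).Nodup := Multiset.nodup_of_le
    (Finset.single_le_sum (f := fun i => pathEnds (Q i)) (by simp) (Finset.mem_univ i))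
    (hends ▸ Finset.nodup _)
  cases hq : Q i with
  | nil => simp [hq, pathEnds] at hi
  | cons a l =>
    rw [hq] at hnd
    refine ⟨a, l.getLastD a, ?_, rfl, ?_, ?_, ?_⟩
    · simpa [pathEnds] using hnd
    · rw [List.getLast?_cons, List.getLastD_eq_getLast?]
    · simp [pathEnds]
    · simp [pathEnds]

/-- The vertices can be distributed among the paths through them, each path keeping its ends. -/
theorem exists_assignment [Fintype V] [DecidableEq V] (G : SimpleGraph V) [DecidableRel G.Adj]
    (hG : G.Connected) (hm : 2 ≤ Fintype.card V) {κ : Type*} [Fintype κ]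
    (hp : 2 * Fintype.card κ = G.oddCount) {Q : κ → List V}
    (hQ : ∀ i, (Q i).Nodup) (hE : ∑ i, pathEdges (Q i) = G.edgeFinset.val) :
    ∃ q : V → κ, (∀ v, v ∈ Q (q v)) ∧ ∀ v i, v ∈ pathEnds (Q i) → q v = i := by
  classical
  have hends := sum_pathEnds_eq G hp hQ hE
  have huniq : ∀ v i j, v ∈ pathEnds (Q i) → v ∈ pathEnds (Q j) → i = j := by
    intro v i j hi hj
    by_contra hij
    have h1 : (∑ i, pathEnds (Q i)).count v ≤ 1 :=
      Multiset.nodup_iff_count_le_one.1 (hends ▸ Finset.nodup _) v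
    have h2 : ∑ k ∈ {i, j}, (pathEnds (Q k)).count v ≤ (∑ i, pathEnds (Q i)).count v := by
      rw [Multiset.count_sum']
      exact Finset.sum_le_sum_of_subset (Finset.subset_univ _)
    rw [Finset.sum_pair hij] at h2
    have := Multiset.count_pos.2 hi
    have := Multiset.count_pos.2 hj
    omega
  have : ∀ v, ∃ i, v ∈ Q i ∧ ∀ j, v ∈ pathEnds (Q j) → i = j := by
    intro v
    by_cases hv : ∃ i, v ∈ pathEnds (Q i)
    · obtain ⟨i, hi⟩ := hv
      exact ⟨i, mem_of_mem_pathEnds hi, fun j hj => huniq v i j hi hj⟩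
    · have : Nontrivial V := Fintype.one_lt_card_iff_nontrivial.1 hm
      obtain ⟨w, hw⟩ := hG.preconnected.exists_adj_of_nontrivial v
      have he : s(v, w) ∈ ∑ i, pathEdges (Q i) := by
        rw [hE]
        exact mem_edgeFinset.2 hw
      obtain ⟨i, -, hi⟩ := Multiset.mem_sum.1 he
      exact ⟨i, mem_of_mem_pathEdges hi (by simp), fun j hj => (hv ⟨j, hj⟩).elim⟩
  choose q hq using this
  exact ⟨q, fun v => (hq v).1, fun v => (hq v).2⟩

theorem multiset_map_sum {α β κ : Type*} (g : α → β) (s : Finset κ) (f : κ → Multiset α) :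
    (∑ i ∈ s, f i).map g = ∑ i ∈ s, (f i).map g :=
  map_sum (Multiset.mapAddMonoidHom g) f s

end

/-- If `p(G) = n_o(G)/2` then `p(G □ H) ≤ mn/2`. -/
theorem pathNumber_boxProd_le_of_pathNumber_eq {V W : Type*} [Fintype V] [Fintype W]
    (G : SimpleGraph V) [DecidableRel G.Adj] (H : SimpleGraph W)
    (hG : G.Connected) (hm : 2 ≤ Fintype.card V) (hH : H.Connected)
    (hp : 2 * G.pathNumber = G.oddCount) :
    2 * (G □ H).pathNumber ≤ Fintype.card V * Fintype.card W := by
  classical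
  obtain ⟨Q, hQ, hQE⟩ := exists_paths_of_pathNumber G
  rw [← Fintype.card_fin G.pathNumber] at hp
  obtain ⟨q, hq, hqe⟩ := exists_assignment G hG hm hp hQ hQE
  obtain ⟨S, R, t, hR, ht, hRE, hS⟩ := exists_directed_paths H.edgeFinset fun e he =>
    H.not_isDiag_of_mem_edgeSet (mem_edgeFinset.1 he)
  have hfilter : ∀ i, (((Q i).filter (· ∈ Finset.univ.filter fun v => q v = i) : List V) :
      Multiset V) = (Finset.univ.filter fun v => q v = i).val := by
    intro i
    refine (Multiset.Nodup.ext (Multiset.coe_nodup.2 ((hQ i).filter _)) (Finset.nodup _)).2 ?_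
    intro v
    have := hq v
    simp
    grind
  have hC : ∀ i, ∃ C : Multiset (List (V × W)), (∀ l ∈ C, l.Nodup) ∧
      (C.map pathEdges).sum = ∑ w, pathEdges ((Q i).map (·, w)) +
        ∑ z with q z = i, ∑ w ∈ S, pathEdges ((R w).map (z, ·)) ∧
      2 * C.card ≤ (Finset.univ.filter fun z => q z = i).card * Fintype.card W := by
    intro i
    obtain ⟨a, b, hab, ha, hb, ha', hb'⟩ := exists_ends G hp hQ hQE i
    obtain ⟨C, hC, hCE, hcard⟩ := exists_paths_over_path hR ht hS
      (Finset.univ.filter fun v => q v = i) (hQ i) ha hb hab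
      (by simpa using hqe a i ha') (by simpa using hqe b i hb')
    refine ⟨C, hC, ?_, ?_⟩
    · rw [hCE, ← Multiset.sum_coe, ← Multiset.map_coe, hfilter]
      rfl
    · rwa [← Multiset.coe_card, hfilter] at hcard
  choose C hC hCE hcard using hC
  have hsum : ((∑ i, C i).map pathEdges).sum = ∑ w, G.edgeFinset.val.map (Sym2.map (·, w)) +
      ∑ u : V, H.edgeFinset.val.map (Sym2.map (u, ·)) := by
    have hadd := map_sum Multiset.sumAddMonoidHom (fun i => (C i).map pathEdges) Finset.univ
    rw [multiset_map_sum, ← Multiset.coe_sumAddMonoidHom, hadd]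
    simp only [Multiset.coe_sumAddMonoidHom, hCE]
    rw [Finset.sum_add_distrib, Finset.sum_comm, Finset.sum_fiberwise, ← hQE, ← hRE]
    simp only [pathEdges_map, multiset_map_sum]
  have hle : (G □ H).pathNumber ≤ (∑ i, C i).card := by
    refine pathNumber_le_of_paths _ ?_ ?_ ?_
    · intro l hl
      obtain ⟨i, -, hi⟩ := Multiset.mem_sum.1 hl
      exact hC i l hi
    · rw [hsum]
      exact nodup_boxProd_edges G H
    · intro e
      rw [hsum]
      exact mem_boxProd_edges G H e
  calc 2 * (G □ H).pathNumber ≤ 2 * (∑ i, C i).card := by omega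
    _ = ∑ i, 2 * (C i).card := by rw [Multiset.card_sum, Finset.mul_sum]
    _ ≤ ∑ i, (Finset.univ.filter fun z => q z = i).card * Fintype.card W :=
      Finset.sum_le_sum fun i _ => hcard i
    _ = Fintype.card V * Fintype.card W := by
      rw [← Finset.sum_mul, ← Finset.card_univ (α := V),
        Finset.card_eq_sum_card_fiberwise (f := q) (t := Finset.univ) (by simp)]
end

section
/- Let m ≥ 2 be an integer, let P_m denote the path on m vertices, and let H be a connected simple graph. Then p(P_m □ H) ≤ m·n_o(H)/2 + n_e(H), where n_o(H) and n_e(H) are the numbers of odd-degree and even-degree vertices of H. -/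
open SimpleGraph

/-- `n_e(G)`: the number of vertices of `G` of even degree. -/
def SimpleGraph.evenCount {V : Type*} [Fintype V] (G : SimpleGraph V)
    [DecidableRel G.Adj] : ℕ :=
  (Finset.univ.filter fun v => Even (G.degree v)).card

namespace PathDecomp

open Multiset

variable {V : Type*}

/-- The multiset of edges joining consecutive entries of a list of vertices. -/
def listEdges : List V → Multiset (Sym2 V)
  | [] => 0
  | [_] => 0
  | a :: b :: l => s(a, b) ::ₘ listEdges (b :: l)

/-- The multiset of all edges used by a multiset of vertex lists. -/
def totalEdges (Q : Multiset (List V)) : Multiset (Sym2 V) := (Q.map listEdges).sum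

/-- The multiset of all end vertices; a list with a single vertex counts twice. -/
def totalEnds (Q : Multiset (List V)) : Multiset (Option V) :=
  Q.map List.head? + Q.map List.getLast?

/-- All members are nonempty and free of repetitions. -/
def AllPaths (Q : Multiset (List V)) : Prop := ∀ l ∈ Q, l ≠ [] ∧ l.Nodup

@[simp] lemma totalEdges_cons (l : List V) (Q : Multiset (List V)) :
    totalEdges (l ::ₘ Q) = listEdges l + totalEdges Q := by simp [totalEdges]

lemma totalEnds_cons (l : List V) (Q : Multiset (List V)) :
    totalEnds (l ::ₘ Q) = l.head? ::ₘ l.getLast? ::ₘ totalEnds Q := by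
  simp [totalEnds, Multiset.cons_swap l.head?]

lemma allPaths_cons {l : List V} {Q : Multiset (List V)} :
    AllPaths (l ::ₘ Q) ↔ (l ≠ [] ∧ l.Nodup) ∧ AllPaths Q := by
  simp [AllPaths]

lemma listEdges_cons {a b : V} {l : List V} (h : l.head? = some b) :
    listEdges (a :: l) = s(a, b) ::ₘ listEdges l := by
  cases l with
  | nil => simp at h
  | cons c l => simp at h; subst h; rfl

lemma listEdges_append {l₁ l₂ : List V} {x y : V} (h₁ : l₁.getLast? = some x)
    (h₂ : l₂.head? = some y) :
    listEdges (l₁ ++ l₂) = listEdges l₁ + s(x, y) ::ₘ listEdges l₂ := by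
  induction l₁ with
  | nil => simp at h₁
  | cons a l ih =>
    cases l with
    | nil =>
      simp at h₁
      subst h₁
      simp [listEdges_cons h₂, listEdges]
    | cons b l =>
      have := ih (by simpa using h₁)
      simp only [List.cons_append, listEdges] at this ⊢
      rw [this, cons_add]

@[simp] lemma listEdges_reverse (l : List V) : listEdges l.reverse = listEdges l := by
  induction l with
  | nil => rfl
  | cons a l ih =>
    cases l with
    | nil => rfl
    | cons b l =>
      rw [List.reverse_cons, listEdges_append (x := b) (y := a) (by simp) (by simp), ih]
      simp only [listEdges]
      rw [Sym2.eq_swap, ← singleton_add, add_comm]; rfl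

lemma listEdges_map {U : Type*} (f : V → U) (l : List V) :
    listEdges (l.map f) = (listEdges l).map (Sym2.map f) := by
  induction l with
  | nil => rfl
  | cons a l ih =>
    cases l with
    | nil => rfl
    | cons b l => simpa [listEdges] using ih

lemma AllPaths.reverse {l : List V} {Q : Multiset (List V)} (h : AllPaths (l.reverse ::ₘ Q)) :
    AllPaths (l ::ₘ Q) := by
  simpa [allPaths_cons] using h

lemma totalEnds_reverse (l : List V) (Q : Multiset (List V)) :
    totalEnds (l.reverse ::ₘ Q) = totalEnds (l ::ₘ Q) := by
  simp [totalEnds_cons, Multiset.cons_swap l.head?]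

/-- `v` is the end of a member of `Q` which, read from `v`, does not enter `a` from a vertex
of `S`. -/
def HasFreeEnd (a : V) (S : Finset V) (Q : Multiset (List V)) (v : V) : Prop :=
  ∃ l, (l ∈ Q ∨ l.reverse ∈ Q) ∧ l.head? = some v ∧
    ∀ l₁ l₂, l = l₁ ++ a :: l₂ → ∀ x ∈ S, l₁.getLast? ≠ some x

lemma mem_totalEdges_of_append {a x : V} {l l₁ l₂ : List V} {Q : Multiset (List V)}
    (hl : l ∈ Q ∨ l.reverse ∈ Q) (h : l = l₁ ++ a :: l₂) (hx : l₁.getLast? = some x) :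
    s(a, x) ∈ totalEdges Q := by
  have h₀ : s(a, x) ∈ listEdges l := by
    rw [h, listEdges_append hx (y := a) (by simp), Sym2.eq_swap]
    simp
  rcases hl with hl | hl
  · obtain ⟨R, rfl⟩ := exists_cons_of_mem hl
    simp [h₀]
  · obtain ⟨R, rfl⟩ := exists_cons_of_mem hl
    simp [h₀]

/-- Given a path decomposition `Q` in which every vertex other than `a` has a free end,
the edge `ab` can be added so that one end moves from `b` to `a`. -/
lemma exists_add_edge_aux_s4 [Fintype V] [DecidableEq V] (a : V) (n : ℕ) :
    ∀ (S : Finset V) (Q : Multiset (List V)) (b : V), Sᶜ.card = n → AllPaths Q →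
      (totalEdges Q).Nodup → b ≠ a → b ∉ S → s(a, b) ∉ totalEdges Q →
      (∀ v, v ≠ a → v ∉ S → HasFreeEnd a S Q v) →
      ∃ Q', AllPaths Q' ∧ totalEdges Q' = s(a, b) ::ₘ totalEdges Q ∧
        some b ::ₘ totalEnds Q' = some a ::ₘ totalEnds Q := by
  induction n using Nat.strong_induction_on with
  | _ n ih =>
  intro S Q b hn hQ hE hba hbS hab hfree
  obtain ⟨l, hlQ, hlb, hlS⟩ := hfree b hba hbS
  obtain ⟨R, hR, hRE, hRD, hmem⟩ : ∃ R, AllPaths (l ::ₘ R) ∧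
      totalEdges (l ::ₘ R) = totalEdges Q ∧ totalEnds (l ::ₘ R) = totalEnds Q ∧
      ∀ k, (k ∈ Q ∨ k.reverse ∈ Q) → (k ∈ l ::ₘ R ∨ k.reverse ∈ l ::ₘ R) := by
    rcases hlQ with h | h
    · obtain ⟨R, rfl⟩ := exists_cons_of_mem h
      exact ⟨R, hQ, rfl, rfl, fun k hk => hk⟩
    · obtain ⟨R, rfl⟩ := exists_cons_of_mem h
      refine ⟨R, hQ.reverse, by simp, (totalEnds_reverse _ _).symm, fun k hk => ?_⟩
      simp only [mem_cons, List.reverse_inj] at hk ⊢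
      rcases hk with (rfl | hk) | (rfl | hk) <;> simp [*]
  have hfree' : ∀ v, v ≠ a → v ∉ S → HasFreeEnd a S (l ::ₘ R) v := by
    intro v hv hvS
    obtain ⟨k, hk, h⟩ := hfree v hv hvS
    exact ⟨k, hmem k hk, h⟩
  rw [← hRE] at hE hab ⊢
  rw [← hRD]
  clear hfree hlQ hmem hRE hRD hQ Q
  obtain ⟨⟨hl0, hlN⟩, hRP⟩ := allPaths_cons.1 hR
  by_cases hal : a ∈ l
  · obtain ⟨l₁, l₂, rfl⟩ := List.append_of_mem hal
    obtain ⟨x, hx⟩ : ∃ x, l₁.getLast? = some x := by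
      cases l₁ with
      | nil => simp at hlb; exact absurd hlb.symm hba
      | cons c t => exact ⟨_, List.getLast?_eq_some_getLast (by simp)⟩
    have hl₁b : l₁.head? = some b := by
      cases l₁ with
      | nil => simp at hx
      | cons c t => simpa using hlb
    have hxS : x ∉ S := fun h => hlS _ _ rfl x h hx
    have hxa : x ≠ a := by
      rintro rfl
      have := List.mem_of_getLast? hx
      grind
    have hxE : s(a, x) ∈ totalEdges ((l₁ ++ a :: l₂) ::ₘ R) :=
      mem_totalEdges_of_append (Or.inl (mem_cons_self _ _)) rfl hx
    have hxb : x ≠ b := by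
      rintro rfl
      exact hab hxE
    have hE' : s(a, x) ::ₘ totalEdges ((l₁.reverse ++ a :: l₂) ::ₘ R) =
        s(a, b) ::ₘ totalEdges ((l₁ ++ a :: l₂) ::ₘ R) := by
      rw [totalEdges_cons, totalEdges_cons, listEdges_append hx (y := a) (by simp),
        listEdges_append (x := b) (y := a) (by simpa using hl₁b) (by simp), listEdges_reverse,
        Sym2.eq_swap (a := x), Sym2.eq_swap (a := b)]
      simp only [← singleton_add]
      abel
    have hD' : some b ::ₘ totalEnds ((l₁.reverse ++ a :: l₂) ::ₘ R) =
        some x ::ₘ totalEnds ((l₁ ++ a :: l₂) ::ₘ R) := by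
      rw [totalEnds_cons, totalEnds_cons]
      have h1 : (l₁.reverse ++ a :: l₂).head? = some x := by simp [hx]
      have h2 : (l₁.reverse ++ a :: l₂).getLast? = (l₁ ++ a :: l₂).getLast? := by
        simp [List.getLast?_cons]
      rw [h1, h2, hlb, Multiset.cons_swap]
    have hN' : (s(a, x) ::ₘ totalEdges ((l₁.reverse ++ a :: l₂) ::ₘ R)).Nodup := by
      rw [hE']
      exact nodup_cons.2 ⟨hab, hE⟩
    obtain ⟨hN1, hN2⟩ := nodup_cons.1 hN'
    obtain ⟨Q', hQ', hQE, hQD⟩ := ih (insert b S)ᶜ.card (by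
        rw [← hn]
        apply Finset.card_lt_card
        rw [Finset.compl_ssubset_compl]
        exact Finset.ssubset_insert hbS) (insert b S) ((l₁.reverse ++ a :: l₂) ::ₘ R) x rfl
        (allPaths_cons.2 ⟨⟨by simp, by
          have : (l₁.reverse ++ a :: l₂).Perm (l₁ ++ a :: l₂) :=
            (List.reverse_perm _).append_right _
          exact this.nodup_iff.2 hlN⟩, hRP⟩) hN2 hxa (by simp [hxb, hxS]) hN1 (by
      intro v hva hvS
      simp only [Finset.mem_insert, not_or] at hvS
      obtain ⟨k, hk, hkv, hkS⟩ := hfree' v hva hvS.2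
      have hkb : ∀ k₁ k₂, k = k₁ ++ a :: k₂ → ∀ y ∈ insert b S, k₁.getLast? ≠ some y := by
        intro k₁ k₂ h y hy hy'
        rcases Finset.mem_insert.1 hy with rfl | hy
        · exact hab (mem_totalEdges_of_append hk h hy')
        · exact hkS _ _ h _ hy hy'
      by_cases hkR : k ∈ R ∨ k.reverse ∈ R
      · exact ⟨k, hkR.imp mem_cons_of_mem mem_cons_of_mem, hkv, hkb⟩
      have hk' : k = l₂.reverse ++ a :: l₁.reverse := by
        simp only [mem_cons] at hk
        rcases hk with (rfl | hk) | (hk | hk)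
        · rw [hlb] at hkv
          exact absurd (Option.some_injective _ hkv).symm hvS.1
        · exact absurd (Or.inl hk) hkR
        · rw [← List.reverse_inj, hk]
          simp
        · exact absurd (Or.inr hk) hkR
      have hl₂ : l₂ ≠ [] := by
        rintro rfl
        simp [hk'] at hkv
        exact hva hkv.symm
      refine ⟨l₂.reverse ++ a :: l₁, Or.inr (by simp), ?_, ?_⟩
      · rw [hk'] at hkv
        cases h : l₂.reverse with
        | nil => simp at h; exact absurd h hl₂
        | cons c t => simpa [h] using hkv
      · intro k₁ k₂ h
        have ha2 : a ∉ l₂.reverse := by grind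
        have ha1 : a ∉ l₁ := by grind
        have : k₁ = l₂.reverse := by
          rcases List.append_eq_append_iff.1 h with ⟨t, h1, h2⟩ | ⟨t, h1, h2⟩
          · cases t with
            | nil => simpa using h1
            | cons c t =>
              simp at h2
              exfalso; apply ha1; rw [h2.2]; simp
          · cases t with
            | nil => simpa using h1.symm
            | cons c t =>
              simp at h2
              exfalso; apply ha2; rw [h1, h2.1]; simp
        rw [this]
        exact hkb _ _ hk')
    refine ⟨Q', hQ', by rw [hQE, hE'], ?_⟩
    have : some x ::ₘ some b ::ₘ totalEnds Q' =
        some x ::ₘ some a ::ₘ totalEnds ((l₁ ++ a :: l₂) ::ₘ R) := by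
      rw [Multiset.cons_swap, hQD, Multiset.cons_swap, hD', Multiset.cons_swap]
    exact (Multiset.cons_inj_right _).1 this
  · refine ⟨(a :: l) ::ₘ R, allPaths_cons.2 ⟨⟨by simp, by simp [hal, hlN]⟩, hRP⟩, ?_, ?_⟩
    · simp [listEdges_cons hlb]
    · have : (a :: l).getLast? = l.getLast? := by
        cases l with
        | nil => exact absurd rfl hl0
        | cons c t => simp
      rw [totalEnds_cons, totalEnds_cons, this, hlb, List.head?_cons, Multiset.cons_swap]

lemma exists_add_edge_s4 [Fintype V] [DecidableEq V] {a b : V} {Q : Multiset (List V)}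
    (hQ : AllPaths Q) (hE : (totalEdges Q).Nodup) (hba : b ≠ a) (hab : s(a, b) ∉ totalEdges Q)
    (hfree : ∀ v ≠ a, some v ∈ totalEnds Q) :
    ∃ Q', AllPaths Q' ∧ totalEdges Q' = s(a, b) ::ₘ totalEdges Q ∧
      some b ::ₘ totalEnds Q' = some a ::ₘ totalEnds Q := by
  refine exists_add_edge_aux_s4 a _ ∅ Q b rfl hQ hE hba (by simp) hab fun v hv _ => ?_
  have := hfree v hv
  simp only [totalEnds, mem_add, mem_map] at this
  rcases this with ⟨l, hl, h⟩ | ⟨l, hl, h⟩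
  · exact ⟨l, Or.inl hl, h, by simp⟩
  · exact ⟨l.reverse, Or.inr (by simpa using hl), by simpa using h, by simp⟩

/-- The number of elements of `F` containing `v`. -/
def edgeDegree [DecidableEq V] (F : Finset (Sym2 V)) (v : V) : ℕ := (F.filter (v ∈ ·)).card

lemma edgeDegree_erase [DecidableEq V] {F : Finset (Sym2 V)} {a b : V} (h : s(a, b) ∈ F) (v : V) :
    edgeDegree F v = edgeDegree (F.erase s(a, b)) v + if v = a ∨ v = b then 1 else 0 := by
  unfold edgeDegree
  rw [Finset.filter_erase]
  split_ifs with hv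
  · rw [Finset.card_erase_add_one]
    simp [h, hv]
  · rw [Finset.erase_eq_of_notMem]
    · rfl
    · simp [h, hv]

/-- `Q` is a decomposition of the edge set `F` into paths in which the vertex `v` occurs
`f v` times as an end. -/
def IsDecompWithEnds [DecidableEq V] (F : Finset (Sym2 V)) (f : V → ℕ)
    (Q : Multiset (List V)) : Prop :=
  AllPaths Q ∧ totalEdges Q = F.val ∧ ∀ v, count (some v) (totalEnds Q) = f v

lemma IsDecompWithEnds.exists_of_erase [Fintype V] [DecidableEq V] {F : Finset (Sym2 V)}
    {f g : V → ℕ} {a b : V} (h : ∃ Q, IsDecompWithEnds (F.erase s(a, b)) f Q) (hab : s(a, b) ∈ F)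
    (hne : a ≠ b) (hf : ∀ v ≠ a, f v ≠ 0)
    (hg : ∀ v, g v + (if v = b then 1 else 0) = f v + if v = a then 1 else 0) :
    ∃ Q, IsDecompWithEnds F g Q := by
  obtain ⟨Q, hQ, hE, hD⟩ := h
  obtain ⟨Q', hQ', hE', hD'⟩ := exists_add_edge_s4 (a := a) (b := b) hQ
    (by rw [hE]; exact Finset.nodup _) hne.symm
    (by rw [hE]; exact Finset.notMem_erase _ _)
    (fun v hv => by rw [← one_le_count_iff_mem, hD]; exact Nat.one_le_iff_ne_zero.2 (hf v hv))
  refine ⟨Q', hQ', ?_, fun v => ?_⟩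
  · rw [hE', hE, Finset.erase_val, cons_erase (by simpa using hab)]
  · have := congrArg (count (some v)) hD'
    rw [count_cons, count_cons, hD] at this
    simp only [Option.some.injEq] at this
    have := hg v
    omega

/-- The number of path ends at a vertex: one if its degree is odd and two otherwise. -/
def targetEnds [DecidableEq V] (F : Finset (Sym2 V)) (v : V) : ℕ :=
  if Odd (edgeDegree F v) then 1 else 2

lemma exists_decomp_empty [Fintype V] [DecidableEq V] :
    ∃ Q : Multiset (List V), IsDecompWithEnds ∅ (targetEnds ∅) Q := by
  refine ⟨Finset.univ.val.map fun v => [v], ?_, ?_, fun v => ?_⟩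
  · intro l hl
    obtain ⟨v, -, rfl⟩ := mem_map.1 hl
    simp
  · simp [totalEdges, listEdges]
  · have h : count (some v) (Finset.univ.val.map (some : V → Option V)) = 1 := by
      rw [count_map_eq_count' _ _ (Option.some_injective V)]
      exact count_eq_one_of_mem (Finset.nodup _) (by simp)
    simp only [totalEnds, Multiset.map_map, Function.comp_def, List.head?_cons,
      List.getLast?_singleton, count_add]
    rw [h]
    simp [targetEnds, edgeDegree]

lemma exists_mem_listEdges_of_head? {l : List V} {v : V} (h : l.head? = some v) (hl : l ≠ [v]) :
    ∃ e ∈ listEdges l, v ∈ e := by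
  match l with
  | [] => simp at h
  | [a] => simp at h; simp [h] at hl
  | a :: b :: l => simp at h; simp [listEdges, h]

lemma IsDecompWithEnds.exists_of_isolated [DecidableEq V] {F : Finset (Sym2 V)} {f : V → ℕ} {z : V}
    (h : ∃ Q, IsDecompWithEnds F f Q) (hz : edgeDegree F z = 0) (hf : f z = 2) :
    ∃ Q, IsDecompWithEnds F (fun v => if v = z then 0 else f v) Q := by
  obtain ⟨Q, hQ, hE, hD⟩ := h
  have hzQ : ∀ l ∈ Q, ∀ e ∈ listEdges l, z ∉ e := by
    intro l hl e he hze
    have : e ∈ F := by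
      rw [← Finset.mem_val, ← hE]
      obtain ⟨R, rfl⟩ := exists_cons_of_mem hl
      simp [he]
    simp only [edgeDegree, Finset.card_eq_zero, Finset.filter_eq_empty_iff] at hz
    exact hz this hze
  have hmem : [z] ∈ Q := by
    have : some z ∈ totalEnds Q := by rw [← one_le_count_iff_mem, hD, hf]; simp
    simp only [totalEnds, mem_add, mem_map] at this
    rcases this with ⟨l, hl, h⟩ | ⟨l, hl, h⟩
    · by_cases hlz : l = [z]
      · exact hlz ▸ hl
      · obtain ⟨e, he, hze⟩ := exists_mem_listEdges_of_head? h hlz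
        exact absurd hze (hzQ l hl e he)
    · by_cases hlz : l = [z]
      · exact hlz ▸ hl
      · obtain ⟨e, he, hze⟩ := exists_mem_listEdges_of_head? (l := l.reverse) (by simpa using h)
          (by rw [ne_eq, List.reverse_eq_iff]; simpa using hlz)
        exact absurd hze (hzQ l hl e (by simpa using he))
  obtain ⟨R, rfl⟩ := exists_cons_of_mem hmem
  refine ⟨R, (allPaths_cons.1 hQ).2, by simpa [listEdges] using hE, fun v => ?_⟩
  have := hD v
  rw [totalEnds_cons, count_cons, count_cons] at this
  simp only [List.head?_cons, List.getLast?_singleton, Option.some.injEq] at this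
  by_cases hv : v = z
  · subst hv
    simp only [if_true] at this ⊢
    omega
  · simpa [hv] using this

/-- A strengthening of Lovász's theorem: every edge set has a path decomposition with one end at
each odd vertex and two ends at each even vertex, and one even vertex may be exempted from
being an end. -/
lemma exists_decomp_aux_s4 [Fintype V] [DecidableEq V] (n : ℕ) :
    ∀ F : Finset (Sym2 V), F.card = n → (∀ e ∈ F, ¬ e.IsDiag) →
      (∃ Q, IsDecompWithEnds F (targetEnds F) Q) ∧
      ∀ z, Even (edgeDegree F z) →
        ∃ Q, IsDecompWithEnds F (fun v => if v = z then 0 else targetEnds F v) Q := by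
  induction n using Nat.strong_induction_on with
  | _ n ih =>
  intro F hn hF
  have ih' : ∀ a b, s(a, b) ∈ F → (∃ Q, IsDecompWithEnds (F.erase s(a, b))
        (targetEnds (F.erase s(a, b))) Q) ∧
      ∀ z, Even (edgeDegree (F.erase s(a, b)) z) → ∃ Q, IsDecompWithEnds (F.erase s(a, b))
        (fun v => if v = z then 0 else targetEnds (F.erase s(a, b)) v) Q := fun a b h =>
    ih _ (hn ▸ Finset.card_erase_lt_of_mem h) _ rfl fun e he => hF e (Finset.mem_of_mem_erase he)
  have hne : ∀ a b, s(a, b) ∈ F → a ≠ b := fun a b h => by simpa using hF _ h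
  have hpos : ∀ (F' : Finset (Sym2 V)) v, targetEnds F' v ≠ 0 := fun F' v => by
    unfold targetEnds; split_ifs <;> simp
  have hS : ∃ Q, IsDecompWithEnds F (targetEnds F) Q := by
    by_cases hev : ∃ a b, s(a, b) ∈ F ∧ Even (edgeDegree F b)
    · obtain ⟨a, b, hab, hb⟩ := hev
      have hab' := hne a b hab
      by_cases ha : Even (edgeDegree F a)
      · obtain ⟨Q, hQ, hE, hD⟩ := (ih' a b hab).1
        refine ⟨[a, b] ::ₘ Q, allPaths_cons.2 ⟨by simp [hab'], hQ⟩, ?_, fun v => ?_⟩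
        · simp only [totalEdges_cons, hE, listEdges, Finset.erase_val]
          rw [← cons_erase (show s(a, b) ∈ F.val from hab)]
          simp
        · rw [totalEnds_cons, count_cons, count_cons, hD]
          have h1 := edgeDegree_erase hab v
          simp only [List.head?_cons, List.getLast?_cons_cons, List.getLast?_singleton,
            Option.some.injEq, targetEnds]
          grind
      · refine IsDecompWithEnds.exists_of_erase (a := b) (b := a)
          (f := targetEnds (F.erase s(b, a))) ?_ (Sym2.eq_swap ▸ hab) hab'.symm
          (fun v _ => hpos _ v) fun v => ?_
        · rw [Sym2.eq_swap]; exact (ih' a b hab).1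
        · have h1 := edgeDegree_erase hab v
          rw [Sym2.eq_swap]
          simp only [targetEnds]
          grind
    · push Not at hev
      rcases F.eq_empty_or_nonempty with rfl | ⟨e, he⟩
      · exact exists_decomp_empty
      · induction e using Sym2.ind with
        | _ a b =>
        have hab' := hne a b he
        have hb := hev a b he
        have ha := hev b a (Sym2.eq_swap ▸ he)
        refine IsDecompWithEnds.exists_of_erase ((ih' a b he).2 a ?_) he hab' ?_ fun v => ?_
        · have h1 := edgeDegree_erase he a
          grind
        · intro v hv
          simpa [hv] using hpos _ v
        · have h1 := edgeDegree_erase he v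
          simp only [targetEnds]
          grind
  refine ⟨hS, fun a ha => ?_⟩
  by_cases h0 : edgeDegree F a = 0
  · exact IsDecompWithEnds.exists_of_isolated hS h0 (by simp [targetEnds, h0])
  obtain ⟨b, hab⟩ : ∃ b, s(a, b) ∈ F := by
    obtain ⟨e, he⟩ := Finset.card_pos.1 (Nat.pos_of_ne_zero h0)
    obtain ⟨he, hae⟩ := Finset.mem_filter.1 he
    obtain ⟨b, rfl⟩ := Sym2.mem_iff_exists.1 hae
    exact ⟨b, he⟩
  have hab' := hne a b hab
  by_cases hb : Even (edgeDegree F b)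
  · refine IsDecompWithEnds.exists_of_erase (a := b) (b := a)
      (f := targetEnds (F.erase s(b, a))) ?_ (Sym2.eq_swap ▸ hab) hab'.symm
      (fun v _ => hpos _ v) fun v => ?_
    · rw [Sym2.eq_swap]; exact (ih' a b hab).1
    · have h1 := edgeDegree_erase hab v
      rw [Sym2.eq_swap]
      simp only [targetEnds]
      grind
  · refine IsDecompWithEnds.exists_of_erase (a := b) (b := a)
      (f := fun v => if v = b then 0 else targetEnds (F.erase s(b, a)) v) ?_
      (Sym2.eq_swap ▸ hab) hab'.symm (fun v hv => by simpa [hv] using hpos _ v) fun v => ?_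
    · rw [Sym2.eq_swap]
      refine (ih' a b hab).2 b ?_
      have h1 := edgeDegree_erase hab b
      grind
    · have h1 := edgeDegree_erase hab v
      rw [Sym2.eq_swap]
      simp only [targetEnds]
      grind

lemma exists_cons_cons_of_not_nodup_map {α β : Type*} {f : α → β} {N : Multiset α}
    (h : ¬ (N.map f).Nodup) : ∃ p q N₀, N = p ::ₘ q ::ₘ N₀ ∧ f p = f q := by
  induction N using Multiset.induction with
  | empty => simp at h
  | cons a N ih =>
    rw [map_cons, nodup_cons, not_and_or, not_not] at h
    rcases h with h | h
    · obtain ⟨q, hq, hqa⟩ := mem_map.1 h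
      obtain ⟨N₀, rfl⟩ := exists_cons_of_mem hq
      exact ⟨a, q, N₀, rfl, hqa.symm⟩
    · obtain ⟨p, q, N₀, rfl, hpq⟩ := ih h
      exact ⟨p, q, a ::ₘ N₀, by rw [cons_swap a p, cons_swap a q], hpq⟩

lemma map_fst_add_map_snd_of_map_mk_eq {α : Type*} {N N' : Multiset (α × α)}
    (h : N.map (fun p => s(p.1, p.2)) = N'.map (fun p => s(p.1, p.2))) :
    N.map Prod.fst + N.map Prod.snd = N'.map Prod.fst + N'.map Prod.snd := by
  have key : ∀ M : Multiset (α × α), M.map Prod.fst + M.map Prod.snd =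
      ((M.map (fun p => s(p.1, p.2))).map Sym2.toMultiset).sum := by
    intro M
    induction M using Multiset.induction with
    | empty => rfl
    | cons p M ih =>
      have h : Sym2.toMultiset s(p.1, p.2) = {p.1} + {p.2} := rfl
      simp only [map_cons, sum_cons, ← ih, h]
      simp only [← singleton_add]
      abel
  rw [key, key, h]

/-- A multigraph with maximum degree at most two can be oriented with in- and outdegrees
at most one. -/
lemma exists_orientation_s4 {α : Type*} [DecidableEq α] (n : ℕ) : ∀ N : Multiset (α × α),
    N.card = n → (∀ v, count v (N.map Prod.fst + N.map Prod.snd) ≤ 2) →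
    ∃ N' : Multiset (α × α), N'.map (fun p => s(p.1, p.2)) = N.map (fun p => s(p.1, p.2)) ∧
      (N'.map Prod.fst).Nodup ∧ (N'.map Prod.snd).Nodup := by
  induction n with
  | zero =>
    intro N hN _
    rw [card_eq_zero] at hN
    exact ⟨0, by simp [hN]⟩
  | succ n ih =>
    intro N hN hc
    have merge : ∀ (v x y : α) (N₀ : Multiset (α × α)), N.map (fun p => s(p.1, p.2)) =
        s(v, x) ::ₘ s(v, y) ::ₘ N₀.map (fun p => s(p.1, p.2)) →
        ∃ N' : Multiset (α × α), N'.map (fun p => s(p.1, p.2)) = N.map (fun p => s(p.1, p.2)) ∧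
          (N'.map Prod.fst).Nodup ∧ (N'.map Prod.snd).Nodup := by
      intro v x y N₀ h
      have hends := map_fst_add_map_snd_of_map_mk_eq (N' := (v, x) ::ₘ (v, y) ::ₘ N₀)
        (by simpa using h)
      rw [hends] at hc
      simp only [map_cons, count_add, count_cons] at hc
      obtain ⟨N', hN', h1, h2⟩ := ih ((x, y) ::ₘ N₀) (by
        have := congrArg card h
        simp at this ⊢
        omega) (fun u => by
          have := hc u
          simp only [map_cons, count_add, count_cons]
          omega)
      obtain ⟨a, b, M, rfl, hab, hM⟩ : ∃ a b M, N' = (a, b) ::ₘ M ∧ s(a, b) = s(x, y) ∧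
          M.map (fun p => s(p.1, p.2)) = N₀.map (fun p => s(p.1, p.2)) := by
        have : s(x, y) ∈ N'.map (fun p => s(p.1, p.2)) := by simp [hN']
        obtain ⟨⟨a, b⟩, hp, hpe⟩ := mem_map.1 this
        obtain ⟨M, rfl⟩ := exists_cons_of_mem hp
        refine ⟨a, b, M, rfl, hpe, ?_⟩
        simp only [map_cons] at hN' hpe
        rw [hpe] at hN'
        exact (cons_inj_right _).1 hN'
      have hMe := map_fst_add_map_snd_of_map_mk_eq hM
      have hv0 : count v (M.map Prod.fst + M.map Prod.snd) = 0 := by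
        rw [hMe, count_add]
        have := hc v
        simp at this
        omega
      have hvxy : v ≠ x ∧ v ≠ y := by
        have := hc v
        constructor <;> rintro rfl <;> simp at this <;> omega
      have hvab : v ≠ a ∧ v ≠ b := by
        rcases Sym2.eq_iff.1 hab with ⟨rfl, rfl⟩ | ⟨rfl, rfl⟩
        · exact hvxy
        · exact hvxy.symm
      rw [count_eq_zero, mem_add, not_or] at hv0
      refine ⟨(a, v) ::ₘ (v, b) ::ₘ M, ?_, ?_, ?_⟩
      · rw [h]
        simp only [map_cons, hM]
        rcases Sym2.eq_iff.1 hab with ⟨rfl, rfl⟩ | ⟨rfl, rfl⟩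
        · rw [Sym2.eq_swap]
        · rw [cons_swap, Sym2.eq_swap (a := a)]
      · simp only [map_cons, nodup_cons, mem_cons, not_or] at h1 ⊢
        exact ⟨⟨hvab.1.symm, h1.1⟩, hv0.1, h1.2⟩
      · simp only [map_cons, nodup_cons, mem_cons, not_or] at h2 ⊢
        exact ⟨⟨hvab.2, hv0.2⟩, h2.1, h2.2⟩
    by_cases h1 : (N.map Prod.fst).Nodup
    · by_cases h2 : (N.map Prod.snd).Nodup
      · exact ⟨N, rfl, h1, h2⟩
      · obtain ⟨⟨x, v⟩, ⟨y, w⟩, N₀, rfl, h⟩ := exists_cons_cons_of_not_nodup_map h2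
        obtain rfl : v = w := h
        exact merge v x y N₀ (by simp [Sym2.eq_swap (b := v)])
    · obtain ⟨⟨v, x⟩, ⟨w, y⟩, N₀, rfl, h⟩ := exists_cons_cons_of_not_nodup_map h1
      obtain rfl : v = w := h
      exact merge v x y N₀ (by simp)

lemma exists_reorient (Q : Multiset (List V)) : ∀ N : Multiset (Option V × Option V),
    N.map (fun p => s(p.1, p.2)) = Q.map (fun l => s(l.head?, l.getLast?)) → AllPaths Q →
    ∃ Q', AllPaths Q' ∧ totalEdges Q' = totalEdges Q ∧
      Q'.map (fun l => (l.head?, l.getLast?)) = N := by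
  induction Q using Multiset.induction with
  | empty =>
    intro N hN hQ
    exact ⟨0, hQ, rfl, by simpa using (map_eq_zero.1 hN).symm⟩
  | cons l Q ih =>
    intro N hN hQ
    obtain ⟨hl, hQ⟩ := allPaths_cons.1 hQ
    have : s(l.head?, l.getLast?) ∈ N.map (fun p => s(p.1, p.2)) := by simp [hN]
    obtain ⟨p, hp, hpe⟩ := mem_map.1 this
    obtain ⟨M, rfl⟩ := exists_cons_of_mem hp
    simp only [map_cons] at hN
    rw [hpe, cons_inj_right] at hN
    obtain ⟨Q', hQ', hE, hM⟩ := ih M hN hQ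
    rcases Sym2.eq_iff.1 hpe with ⟨h1, h2⟩ | ⟨h1, h2⟩
    · exact ⟨l ::ₘ Q', allPaths_cons.2 ⟨hl, hQ'⟩, by simp [hE], by simp [hM, ← h1, ← h2]⟩
    · exact ⟨l.reverse ::ₘ Q', allPaths_cons.2 ⟨by simpa using hl, hQ'⟩, by simp [hE],
        by simp [hM, ← h1, ← h2]⟩

/-- The multiset of paths can be reversed individually so that no two share a first vertex and
no two share a last vertex. -/
lemma exists_oriented [DecidableEq V] {Q : Multiset (List V)} (hQ : AllPaths Q)
    (hc : ∀ v, count (some v) (totalEnds Q) ≤ 2) :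
    ∃ Q', AllPaths Q' ∧ totalEdges Q' = totalEdges Q ∧ totalEnds Q' = totalEnds Q ∧
      (Q'.map List.head?).Nodup ∧ (Q'.map List.getLast?).Nodup := by
  have hnone : none ∉ totalEnds Q := by
    simp only [totalEnds, mem_add, mem_map, List.head?_eq_none_iff, List.getLast?_eq_none_iff]
    rintro (⟨l, hl, h⟩ | ⟨l, hl, h⟩) <;> exact (hQ l hl).1 h
  obtain ⟨N, hN, h1, h2⟩ := exists_orientation_s4 _
    (Q.map fun l => (l.head?, l.getLast?)) rfl (fun v => by
      cases v with
      | none =>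
        have := count_eq_zero.2 hnone
        rw [Multiset.map_map, Multiset.map_map]
        change count none (totalEnds Q) ≤ 2
        omega
      | some v => simpa [totalEnds, Function.comp_def] using hc v)
  rw [Multiset.map_map] at hN
  obtain ⟨Q', hQ', hE, rfl⟩ := exists_reorient Q N hN hQ
  refine ⟨Q', hQ', hE, ?_, by simpa [Function.comp_def] using h1,
    by simpa [Function.comp_def] using h2⟩
  have := map_fst_add_map_snd_of_map_mk_eq
    (N := Q'.map fun l => (l.head?, l.getLast?)) (N' := Q.map fun l => (l.head?, l.getLast?))
    (by simpa [Function.comp_def] using hN)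
  simpa [totalEnds, Function.comp_def] using this

/-- An oriented path system indexed by first vertices. -/
lemma exists_path_system [Fintype V] [DecidableEq V] {F : Finset (Sym2 V)}
    (hF : ∀ e ∈ F, ¬ e.IsDiag) :
    ∃ (A B : Finset V) (P : V → List V) (t : V → V),
      (∀ v ∈ A, (P v).head? = some v ∧ (P v).getLast? = some (t v) ∧ (P v).Nodup) ∧
      totalEdges (A.val.map P) = F.val ∧ A.val.map t = B.val ∧
      ∀ v, (if v ∈ A then 1 else 0) + (if v ∈ B then 1 else 0) = targetEnds F v := by
  classical
  obtain ⟨Q₀, hQ₀, hE₀, hD₀⟩ := (exists_decomp_aux_s4 _ F rfl hF).1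
  obtain ⟨Q, hQ, hE, hD, hh, hl⟩ := exists_oriented hQ₀
    (fun v => by rw [hD₀]; unfold targetEnds; split_ifs <;> simp)
  rw [hE₀] at hE
  replace hD : ∀ v, count (some v) (totalEnds Q) = targetEnds F v := by rw [hD]; exact hD₀
  have hQN : Q.Nodup := hh.of_map
  have hP : ∀ v, ∃ l, some v ∈ Q.map List.head? → l ∈ Q ∧ l.head? = some v := by
    intro v
    by_cases h : some v ∈ Q.map List.head?
    · obtain ⟨l, hl⟩ := mem_map.1 h
      exact ⟨l, fun _ => hl⟩
    · exact ⟨[], fun h' => absurd h' h⟩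
  choose P hP using hP
  have ht : ∀ v, ∃ w, some v ∈ Q.map List.head? → (P v).getLast? = some w := by
    intro v
    by_cases h : some v ∈ Q.map List.head?
    · exact ⟨_, fun _ => List.getLast?_eq_some_getLast (hQ _ (hP v h).1).1⟩
    · exact ⟨v, fun h' => absurd h' h⟩
  choose t ht using ht
  set A : Finset V := Finset.univ.filter fun v => some v ∈ Q.map List.head? with hA
  have hAmem : ∀ v, v ∈ A ↔ some v ∈ Q.map List.head? := fun v => by
    simp only [hA, Finset.mem_filter, Finset.mem_univ, true_and]
  have hQA : A.val.map P = Q := by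
    refine (Nodup.ext ?_ hQN).2 fun l => ?_
    · refine Nodup.map_on (fun v hv w hw h => ?_) A.nodup
      have h1 := (hP v ((hAmem v).1 hv)).2
      have h2 := (hP w ((hAmem w).1 hw)).2
      rw [h, h2] at h1
      exact (Option.some_injective _ h1).symm
    · rw [mem_map]
      constructor
      · rintro ⟨v, hv, rfl⟩
        exact (hP v ((hAmem v).1 hv)).1
      · intro hlQ
        obtain ⟨v, hv⟩ : ∃ v, l.head? = some v := by
          rw [← Option.isSome_iff_exists]
          simpa using (hQ l hlQ).1
        have hv' : some v ∈ Q.map List.head? := mem_map.2 ⟨l, hlQ, hv⟩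
        exact ⟨v, (hAmem v).2 hv', inj_on_of_nodup_map hh _ (hP v hv').1 _ hlQ
          ((hP v hv').2.trans hv.symm)⟩
  have hlast : Q.map List.getLast? = (A.val.map t).map some := by
    rw [← hQA, Multiset.map_map, Multiset.map_map]
    exact map_congr rfl fun v hv => ht v ((hAmem v).1 hv)
  have htN : (A.val.map t).Nodup := by
    rw [hlast] at hl
    exact hl.of_map
  refine ⟨A, ⟨A.val.map t, htN⟩, P, t, fun v hv => ?_, by rw [hQA, hE], rfl, fun v => ?_⟩
  · have hv := (hAmem v).1 hv
    exact ⟨(hP v hv).2, ht v hv, (hQ _ (hP v hv).1).2⟩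
  · rw [← hD, totalEnds, count_add, Multiset.count_eq_of_nodup hh, Multiset.count_eq_of_nodup hl]
    congr 1
    · simp only [hAmem]
    · rw [hlast]
      simp only [mem_map_of_injective (Option.some_injective V)]
      rfl

/-- The edges of the product of the path on `k + 1` vertices and the graph with edge set `F`. -/
def gridEdges [Fintype V] (F : Finset (Sym2 V)) : (k : ℕ) → Multiset (Sym2 (Fin (k + 1) × V))
  | 0 => F.val.map (Sym2.map (Prod.mk 0))
  | k + 1 => F.val.map (Sym2.map (Prod.mk 0)) +
      Finset.univ.val.map (fun v => s(((0 : Fin (k + 2)), v), ((1 : Fin (k + 2)), v))) +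
      (gridEdges F k).map (Sym2.map (Prod.map Fin.succ id))

lemma totalEdges_add (Q R : Multiset (List V)) :
    totalEdges (Q + R) = totalEdges Q + totalEdges R := by simp [totalEdges]

lemma totalEdges_map_map {U : Type*} (f : V → U) (Q : Multiset (List V)) :
    totalEdges (Q.map (List.map f)) = (totalEdges Q).map (Sym2.map f) := by
  induction Q using Multiset.induction with
  | empty => rfl
  | cons l Q ih => simp [listEdges_map, ih]

lemma allPaths_map {U : Type*} {f : V → U} (hf : Function.Injective f) {Q : Multiset (List V)}
    (hQ : AllPaths Q) : AllPaths (Q.map (List.map f)) := by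
  intro l hl
  obtain ⟨l', hl', rfl⟩ := mem_map.1 hl
  exact ⟨by simpa using (hQ l' hl').1, (hQ l' hl').2.map hf⟩

lemma prodMap_succ_injective (k : ℕ) :
    Function.Injective (Prod.map Fin.succ id : Fin k × V → Fin (k + 1) × V) :=
  (Fin.succ_injective k).prodMap Function.injective_id

/-- Copies of an oriented path system in the layers are linked by the vertical edges into a
path decomposition of the product. -/
lemma exists_grid_decomp [Fintype V] [DecidableEq V] {F : Finset (Sym2 V)} {A B : Finset V}
    {P : V → List V} {t : V → V}
    (hP : ∀ v ∈ A, (P v).head? = some v ∧ (P v).getLast? = some (t v) ∧ (P v).Nodup)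
    (hE : totalEdges (A.val.map P) = F.val) (ht : A.val.map t = B.val)
    (hAB : ∀ v, v ∈ A ∨ v ∈ B) (k : ℕ) :
    ∃ (g : V → List (Fin (k + 1) × V)) (R : Multiset (List (Fin (k + 1) × V))),
      (∀ v ∈ A, (g v).head? = some (0, v) ∧ (g v).Nodup) ∧ AllPaths R ∧
      totalEdges (A.val.map g + R) = gridEdges F k ∧ R.card = k * (A \ B).card := by
  have hbot : ∀ k : ℕ, totalEdges (A.val.map fun v => (P v).map (Prod.mk (0 : Fin (k + 1)))) =
      F.val.map (Sym2.map (Prod.mk 0)) := by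
    intro k
    rw [← hE, ← totalEdges_map_map, Multiset.map_map]
    rfl
  induction k with
  | zero =>
    refine ⟨fun v => (P v).map (Prod.mk 0), 0, fun v hv => ⟨by simp [(hP v hv).1], ?_⟩,
      by simp [AllPaths], ?_, by simp⟩
    · exact (hP v hv).2.2.map (Prod.mk_right_injective 0)
    · rw [add_zero, hbot]
      rfl
  | succ k ih =>
    obtain ⟨g, R, hg, hR, hgE, hRc⟩ := ih
    set up : List (Fin (k + 1) × V) → List (Fin (k + 2) × V) :=
      List.map (Prod.map Fin.succ id) with hup
    have hup0 : ∀ (l : List (Fin (k + 1) × V)) (v : V), ((0 : Fin (k + 2)), v) ∉ up l := by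
      intro l v h
      obtain ⟨⟨i, u⟩, -, h⟩ := List.mem_map.1 h
      exact Fin.succ_ne_zero i (congrArg Prod.fst h)
    have hupN : ∀ l, l.Nodup → (up l).Nodup := fun l hl => hl.map (prodMap_succ_injective _)
    have huph : ∀ v ∈ A, (up (g v)).head? = some (1, v) := fun v hv => by
      simp [hup, (hg v hv).1]
    set tail : V → List (Fin (k + 2) × V) := fun w => if w ∈ A then up (g w) else [(1, w)]
      with htail
    have htailh : ∀ w, (tail w).head? = some (1, w) := fun w => by
      by_cases hw : w ∈ A
      · simp only [htail, if_pos hw, huph w hw]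
      · simp [htail, if_neg hw]
    have htail0 : ∀ w v, ((0 : Fin (k + 2)), v) ∉ tail w := fun w v => by
      by_cases hw : w ∈ A
      · simp only [htail, if_pos hw, hup0, not_false_eq_true]
      · simp [htail, if_neg hw]
    have htailN : ∀ w, (tail w).Nodup := fun w => by
      by_cases hw : w ∈ A
      · simp only [htail, if_pos hw, hupN _ (hg w hw).2]
      · simp [htail, if_neg hw]
    set vert : V → Sym2 (Fin (k + 2) × V) := fun v => s((0, v), (1, v)) with hvert
    refine ⟨fun v => (P v).map (Prod.mk 0) ++ tail (t v),
      R.map up + (A \ B).val.map (fun v => (0, v) :: up (g v)), fun v hv => ⟨?_, ?_⟩, ?_, ?_, ?_⟩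
    · simp [(hP v hv).1]
    · refine ((hP v hv).2.2.map (Prod.mk_right_injective 0)).append (htailN _) ?_
      intro x hx hx'
      obtain ⟨u, -, rfl⟩ := List.mem_map.1 hx
      exact htail0 _ _ hx'
    · intro l hl
      rcases mem_add.1 hl with hl | hl
      · exact allPaths_map (prodMap_succ_injective _) hR l hl
      · obtain ⟨v, hv, rfl⟩ := mem_map.1 hl
        have hvA : v ∈ A := (Finset.mem_sdiff.1 hv).1
        exact ⟨by simp, List.nodup_cons.2 ⟨hup0 _ _, hupN _ (hg v hvA).2⟩⟩
    · have h1 : totalEdges (A.val.map fun v => (P v).map (Prod.mk 0) ++ tail (t v)) =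
          F.val.map (Sym2.map (Prod.mk 0)) +
            ∑ w ∈ B, ({vert w} + if w ∈ A then listEdges (up (g w)) else 0) := by
        rw [← hbot, Finset.sum_eq_multiset_sum, ← ht, Multiset.map_map, totalEdges,
          totalEdges, Multiset.map_map, Multiset.map_map, ← sum_map_add]
        refine congrArg _ (map_congr rfl fun v hv => ?_)
        simp only [Function.comp_apply]
        rw [listEdges_append (x := (0, t v)) (y := (1, t v)) (by simp [(hP v hv).2.1]) (htailh _),
          ← singleton_add]
        congr 2
        by_cases hw : t v ∈ A
        · simp only [htail, if_pos hw]
        · simp [htail, if_neg hw, listEdges]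
      have h2 : totalEdges ((A \ B).val.map (fun v => (0, v) :: up (g v))) =
          ∑ w ∈ A \ B, ({vert w} + listEdges (up (g w))) := by
        rw [Finset.sum_eq_multiset_sum, totalEdges, Multiset.map_map]
        refine congrArg _ (map_congr rfl fun v hv => ?_)
        have hvA : v ∈ A := (Finset.mem_sdiff.1 hv).1
        rw [Function.comp_apply, listEdges_cons (huph v hvA), singleton_add]
      have h3 : (gridEdges F k).map (Sym2.map (Prod.map Fin.succ id)) =
          ∑ w ∈ A, listEdges (up (g w)) + totalEdges (R.map up) := by
        rw [← hgE, ← totalEdges_map_map, Multiset.map_add, totalEdges_add, Multiset.map_map,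
          Finset.sum_eq_multiset_sum]
        congr 1
        rw [totalEdges, Multiset.map_map]
        rfl
      have h4 : ∑ w ∈ B, ({vert w} + if w ∈ A then listEdges (up (g w)) else 0) +
          ∑ w ∈ A \ B, ({vert w} + listEdges (up (g w))) =
          Finset.univ.val.map vert + ∑ w ∈ A, listEdges (up (g w)) := by
        have h5 : Finset.univ.val.map vert = ∑ w, {vert w} := by
          have := sum_map_singleton (Finset.univ.val.map vert)
          rw [Multiset.map_map] at this
          exact this.symm
        rw [h5, ← Finset.sum_ite_mem_eq B, ← Finset.sum_ite_mem_eq (A \ B),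
          ← Finset.sum_ite_mem_eq A, ← Finset.sum_add_distrib, ← Finset.sum_add_distrib]
        refine Finset.sum_congr rfl fun w _ => ?_
        have := hAB w
        by_cases hA : w ∈ A <;> by_cases hB : w ∈ B <;> simp_all
      rw [totalEdges_add, totalEdges_add, h1, h2, gridEdges, h3, ← hvert]
      generalize F.val.map (Sym2.map (Prod.mk (0 : Fin (k + 2)))) = X
      calc _ = X + (∑ w ∈ B, ({vert w} + if w ∈ A then listEdges (up (g w)) else 0) +
            ∑ w ∈ A \ B, ({vert w} + listEdges (up (g w)))) + totalEdges (R.map up) := by abel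
        _ = _ := by rw [h4]; abel
    · rw [card_add, card_map, card_map, hRc, Finset.card_val]
      ring

lemma forall_mem_map_mk {x : Sym2 V} {k : ℕ} {y : Fin (k + 1) × V}
    (hy : y ∈ Sym2.map (Prod.mk 0) x) : y.1 = 0 := by
  obtain ⟨v, -, rfl⟩ := Sym2.mem_map.1 hy
  rfl

lemma nodup_gridEdges [Fintype V] (F : Finset (Sym2 V)) (k : ℕ) : (gridEdges F k).Nodup := by
  have hbot : ∀ k : ℕ, (F.val.map (Sym2.map (Prod.mk (0 : Fin (k + 1))))).Nodup := fun k =>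
    F.nodup.map (Sym2.map.injective (Prod.mk_right_injective 0))
  induction k with
  | zero => exact hbot 0
  | succ k ih =>
    have h0 : ∀ {x : Sym2 (Fin (k + 1) × V)} {y : Fin (k + 2) × V},
        y ∈ Sym2.map (Prod.map Fin.succ id) x → y.1 ≠ 0 := by
      intro x y hy
      obtain ⟨v, -, rfl⟩ := Sym2.mem_map.1 hy
      exact Fin.succ_ne_zero _
    rw [gridEdges, nodup_add, nodup_add]
    refine ⟨⟨hbot _, Finset.univ.nodup.map fun u v h => ?_, ?_⟩,
      ih.map (Sym2.map.injective (prodMap_succ_injective _)), ?_⟩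
    · rcases Sym2.eq_iff.1 h with ⟨h, -⟩ | ⟨h, -⟩
      · exact congrArg Prod.snd h
      · exact congrArg Prod.snd h
    · rw [Multiset.disjoint_left]
      intro e he he'
      obtain ⟨x, -, rfl⟩ := mem_map.1 he
      obtain ⟨v, -, h⟩ := mem_map.1 he'
      have := forall_mem_map_mk (x := x) (y := ((1 : Fin (k + 2)), v)) (by rw [← h]; simp)
      simp at this
    · rw [Multiset.disjoint_left]
      intro e he he'
      obtain ⟨x, -, rfl⟩ := mem_map.1 he'
      rcases mem_add.1 he with he | he
      · obtain ⟨y, -, h⟩ := mem_map.1 he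
        induction y using Sym2.ind with
        | _ u v => exact h0 (x := x) (y := (0, u)) (by rw [← h]; simp) rfl
      · obtain ⟨v, -, h⟩ := mem_map.1 he
        exact h0 (x := x) (y := (0, v)) (by rw [← h]; simp) rfl

lemma mem_gridEdges [Fintype V] {H : SimpleGraph V} {F : Finset (Sym2 V)}
    (hF : ∀ e, e ∈ F ↔ e ∈ H.edgeSet) (k : ℕ) (e : Sym2 (Fin (k + 1) × V)) :
    e ∈ gridEdges F k ↔ e ∈ (pathGraph (k + 1) □ H).edgeSet := by
  have hbot : ∀ (k : ℕ) {i j : Fin (k + 1)} {u v : V}, s((i, u), (j, v)) ∈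
      F.val.map (Sym2.map (Prod.mk (0 : Fin (k + 1)))) ↔ i = 0 ∧ j = 0 ∧ H.Adj u v := by
    intro k i j u v
    rw [mem_map]
    constructor
    · rintro ⟨x, hx, h⟩
      induction x using Sym2.ind with
      | _ a b =>
      have := (hF _).1 hx
      rw [mem_edgeSet] at this
      rw [Sym2.map_mk, Sym2.eq_iff] at h
      simp only [Prod.mk.injEq] at h
      rcases h with ⟨⟨rfl, rfl⟩, rfl, rfl⟩ | ⟨⟨rfl, rfl⟩, rfl, rfl⟩
      · exact ⟨rfl, rfl, this⟩
      · exact ⟨rfl, rfl, this.symm⟩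
    · rintro ⟨rfl, rfl, h⟩
      exact ⟨s(u, v), (hF _).2 h, rfl⟩
  induction k with
  | zero =>
    induction e using Sym2.ind with
    | _ x y =>
    obtain ⟨i, u⟩ := x
    obtain ⟨j, v⟩ := y
    rw [gridEdges, hbot, mem_edgeSet, boxProd_adj]
    have hi : i = 0 := Fin.fin_one_eq_zero i
    have hj : j = 0 := Fin.fin_one_eq_zero j
    simp [hi, hj]
  | succ k ih =>
    induction e using Sym2.ind with
    | _ x y =>
    obtain ⟨i, u⟩ := x
    obtain ⟨j, v⟩ := y
    have hup : s((i, u), (j, v)) ∈ (gridEdges F k).map (Sym2.map (Prod.map Fin.succ id)) ↔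
        ∃ i' j', i = Fin.succ i' ∧ j = Fin.succ j' ∧
          s((i', u), (j', v)) ∈ (pathGraph (k + 1) □ H).edgeSet := by
      rw [mem_map]
      constructor
      · rintro ⟨x, hx, h⟩
        induction x using Sym2.ind with
        | _ a b =>
        replace hx := (ih _).1 hx
        rw [Sym2.map_mk, Sym2.eq_iff] at h
        obtain ⟨a, a'⟩ := a
        obtain ⟨b, b'⟩ := b
        simp only [Prod.map_apply, id, Prod.mk.injEq] at h
        rcases h with ⟨⟨rfl, rfl⟩, rfl, rfl⟩ | ⟨⟨rfl, rfl⟩, rfl, rfl⟩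
        · exact ⟨_, _, rfl, rfl, hx⟩
        · exact ⟨_, _, rfl, rfl, Sym2.eq_swap ▸ hx⟩
      · rintro ⟨i', j', rfl, rfl, h⟩
        exact ⟨_, (ih _).2 h, rfl⟩
    have hvert : s((i, u), (j, v)) ∈ Finset.univ.val.map
        (fun v => s(((0 : Fin (k + 2)), v), ((1 : Fin (k + 2)), v))) ↔
        u = v ∧ (i = 0 ∧ j = 1 ∨ i = 1 ∧ j = 0) := by
      simp only [mem_map, Finset.mem_val, Finset.mem_univ, true_and, Sym2.eq_iff, Prod.mk.injEq]
      grind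
    have hup' : s((i, u), (j, v)) ∈ (gridEdges F k).map (Sym2.map (Prod.map Fin.succ id)) ↔
        i.val ≠ 0 ∧ j.val ≠ 0 ∧ ((i.val + 1 = j.val ∨ j.val + 1 = i.val) ∧ u = v ∨
          H.Adj u v ∧ i.val = j.val) := by
      rw [hup]
      simp only [mem_edgeSet, boxProd_adj, pathGraph_adj]
      constructor
      · rintro ⟨i', j', rfl, rfl, h⟩
        simp only [Fin.ext_iff] at h
        simp only [Fin.val_succ]
        refine ⟨by omega, by omega, ?_⟩
        rcases h with h | h
        · exact Or.inl ⟨by omega, h.2⟩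
        · exact Or.inr ⟨h.1, by omega⟩
      · rintro ⟨hi, hj, h⟩
        obtain ⟨i', rfl⟩ := Fin.exists_succ_eq.2 fun h => hi (congrArg Fin.val h)
        obtain ⟨j', rfl⟩ := Fin.exists_succ_eq.2 fun h => hj (congrArg Fin.val h)
        refine ⟨i', j', rfl, rfl, ?_⟩
        simp only [Fin.val_succ] at h
        simp only [Fin.ext_iff]
        rcases h with h | h
        · exact Or.inl ⟨by omega, h.2⟩
        · exact Or.inr ⟨h.1, by omega⟩
    rw [gridEdges, mem_add, mem_add, hbot, hup', hvert]
    simp only [mem_edgeSet, boxProd_adj, pathGraph_adj, Fin.ext_iff, Fin.val_zero, Fin.val_one]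
    by_cases hA : H.Adj u v <;> by_cases hE : u = v <;>
      simp only [hA, hE, true_and, and_true, false_and, and_false, or_false, false_or] <;>
      grind

lemma exists_walk_of_listEdges {G : SimpleGraph V} (l : List V) :
    ∀ v, l.head? = some v → (∀ e ∈ listEdges l, e ∈ G.edgeSet) →
      ∃ (u : V) (p : G.Walk v u), p.support = l ∧ (p.edges : Multiset (Sym2 V)) = listEdges l := by
  induction l with
  | nil => simp
  | cons a l ih =>
    intro v hv h
    obtain rfl : a = v := by simpa using hv
    cases l with
    | nil => exact ⟨a, Walk.nil, rfl, rfl⟩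
    | cons b l =>
      simp only [listEdges, mem_cons, forall_eq_or_imp] at h
      obtain ⟨u, p, hp, hpe⟩ := ih b rfl h.2
      have hab : G.Adj a b := h.1
      exact ⟨u, Walk.cons hab p, by simp [hp], by simp [listEdges, ← hpe]⟩

/-- A multiset of vertex lists using every edge of `G` exactly once bounds the path number. -/
lemma pathNumber_le_card {G : SimpleGraph V} {Q : Multiset (List V)} (hQ : AllPaths Q)
    (hN : (totalEdges Q).Nodup) (hE : ∀ e, e ∈ totalEdges Q ↔ e ∈ G.edgeSet) :
    G.pathNumber ≤ Q.card := by
  have key : ∀ Q : Multiset (List V), AllPaths Q → (∀ e ∈ totalEdges Q, e ∈ G.edgeSet) →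
      ∃ P : List (Σ u v : V, G.Walk u v), (∀ p ∈ P, p.2.2.IsPath) ∧
        ((P.flatMap fun p => p.2.2.edges : List (Sym2 V)) : Multiset (Sym2 V)) = totalEdges Q ∧
        P.length = Q.card := by
    intro Q
    induction Q using Multiset.induction with
    | empty => exact fun _ _ => ⟨[], by simp, rfl, rfl⟩
    | cons l Q ih =>
      intro hQ hE
      obtain ⟨⟨hl, hlN⟩, hQ⟩ := allPaths_cons.1 hQ
      simp only [totalEdges_cons, mem_add] at hE
      obtain ⟨P, hP, hPE, hPc⟩ := ih hQ fun e he => hE e (Or.inr he)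
      obtain ⟨v, hv⟩ : ∃ v, l.head? = some v := by
        rw [← Option.isSome_iff_exists]
        simpa using hl
      obtain ⟨u, p, hp, hpe⟩ := exists_walk_of_listEdges l v hv fun e he => hE e (Or.inl he)
      refine ⟨⟨v, u, p⟩ :: P, ?_, ?_, by simp [hPc]⟩
      · simp only [List.mem_cons, forall_eq_or_imp]
        exact ⟨(Walk.isPath_def p).2 (hp ▸ hlN), hP⟩
      · rw [List.flatMap_cons, ← coe_add, hpe, hPE, totalEdges_cons]
  obtain ⟨P, hP, hPE, hPc⟩ := key Q hQ fun e he => (hE e).1 he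
  refine Nat.sInf_le ⟨P, ⟨hP, ?_, fun e he => ?_⟩, hPc⟩
  · rw [← hPE, coe_nodup, List.nodup_flatMap] at hN
    exact hN.2.imp fun h e he he' => h he he'
  · have := (hE e).2 he
    rw [← hPE, mem_coe, List.mem_flatMap] at this
    exact this

end PathDecomp

open PathDecomp in
/-- `p(P_m □ H) ≤ m·n_o(H)/2 + n_e(H)` for connected `H` and `m ≥ 2`. -/
theorem pathNumber_pathGraph_boxProd_le' {W : Type*} [Fintype W] (m : ℕ) (hm : 2 ≤ m)
    (H : SimpleGraph W) [DecidableRel H.Adj] (hH : H.Connected) :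
    2 * (pathGraph m □ H).pathNumber ≤ m * H.oddCount + 2 * H.evenCount := by

  classical
  obtain ⟨k, rfl⟩ : ∃ k, m = k + 1 := ⟨m - 1, by omega⟩
  have hF : ∀ e ∈ H.edgeFinset, ¬ e.IsDiag := fun e he =>
    H.not_isDiag_of_mem_edgeSet (mem_edgeFinset.1 he)
  have hdeg : ∀ v, edgeDegree H.edgeFinset v = H.degree v := fun v => by
    rw [edgeDegree, ← H.card_incidenceFinset_eq_degree, H.incidenceFinset_eq_filter]
  obtain ⟨A, B, P, t, hP, hE, ht, hAB⟩ := exists_path_system hF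
  simp only [targetEnds, hdeg] at hAB
  obtain ⟨g, R, hg, hR, hgE, hRc⟩ := exists_grid_decomp hP hE ht (fun v => by
    have := hAB v
    by_contra h
    push Not at h
    simp only [h.1, h.2, if_false] at this
    split_ifs at this <;> omega) k
  have hle : (pathGraph (k + 1) □ H).pathNumber ≤ (A.val.map g + R).card := by
    refine pathNumber_le_card ?_ ?_ ?_
    · intro l hl
      rcases Multiset.mem_add.1 hl with hl | hl
      · obtain ⟨v, hv, rfl⟩ := Multiset.mem_map.1 hl
        refine ⟨fun h => ?_, (hg v hv).2⟩
        simpa [h] using (hg v hv).1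
      · exact hR l hl
    · rw [hgE]
      exact nodup_gridEdges _ _
    · rw [hgE]
      exact mem_gridEdges (fun e => mem_edgeFinset) k
  have hcard : A.card = B.card := by simpa using congrArg Multiset.card ht
  have hev : H.evenCount = (A ∩ B).card := by
    unfold evenCount
    congr 1
    ext v
    have := hAB v
    simp only [Finset.mem_filter, Finset.mem_univ, true_and, Finset.mem_inter]
    grind
  have hodd : H.oddCount = (A \ B).card + (B \ A).card := by
    unfold oddCount
    rw [← Finset.card_union_of_disjoint disjoint_sdiff_sdiff]
    congr 1
    ext v
    have := hAB v
    simp only [Finset.mem_filter, Finset.mem_univ, true_and, Finset.mem_union, Finset.mem_sdiff]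
    grind
  rw [Multiset.card_add, Multiset.card_map, hRc, Finset.card_val,
    ← Finset.card_sdiff_add_card_inter A B] at hle
  rw [hodd, hev, ← Finset.card_sdiff_comm hcard]
  nlinarith
end
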